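/- arXiv:2008.06619 — 3 statements merged into one kernel-verified Lean document; each statement's English description precedes it below -/
import Mathlib

section
/- Let B be a unital LF C*-algebra and W a unital C*-algebra. If π, ρ : B → W are unital *-homomorphisms such that π(p) ∼ ρ(p) in W for every projection p ∈ B, then π ∼_a ρ in W, i.e. there is a net {U_λ} of unitaries in W with ‖U_λ π(b) U_λ* − ρ(b)‖ → 0 for every b ∈ B. -/
/-!
Statement 1: If `B` is a unital LF C*-algebra, `W` a unital C*-algebra, and `π, ρ : B → W`
are unital *-homomorphisms such that `π(p) ∼ ρ(p)` (Murray–von Neumann) in `W` for every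
projection `p ∈ B`, then `π ∼ₐ ρ` in `W`: there is a net `{U_λ}` of unitaries of `W` with
`‖U_λ π(b) U_λ* − ρ(b)‖ → 0` for every `b ∈ B`.
-/

/-- Murray-von Neumann equivalence of two elements (typically projections) in a star algebra. -/
def MvNEquiv {R : Type*} [Mul R] [Star R] (p q : R) : Prop :=
  ∃ v : R, star v * v = p ∧ v * star v = q

/-- A projection in a *-algebra: a self-adjoint idempotent. -/
def IsProjElem {R : Type*} [Mul R] [Star R] (p : R) : Prop := star p = p ∧ p * p = p

/-- A C*-algebra is LF if every finite subset can be approximated within `ε` by elements of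
a finite-dimensional C*-subalgebra. -/
def IsLF (B : Type*) [NormedRing B] [StarRing B] [NormedAlgebra ℂ B] [StarModule ℂ B] : Prop :=
  ∀ (F : Finset B) (ε : ℝ), 0 < ε →
    ∃ D : StarSubalgebra ℂ B, FiniteDimensional ℂ D ∧
      ∀ b ∈ F, ∃ d ∈ D, ‖b - d‖ < ε

/-- Approximate unitary equivalence of two maps into a C*-algebra `W`: there is a net of
unitaries of `W` conjugating one to the other asymptotically in norm. -/
def ApproxUnitEquiv {A : Type u} {W : Type v} [NormedRing W] [StarRing W]
    (π ρ : A → W) : Prop :=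
  ∃ (ι : Type (max u v)) (l : Filter ι), l.NeBot ∧
    ∃ U : ι → W, (∀ i, star (U i) * U i = 1 ∧ U i * star (U i) = 1) ∧
      ∀ a : A, Filter.Tendsto (fun i => ‖U i * π a * star (U i) - ρ a‖) l (nhds 0)

theorem IsProjElem.sub {R : Type*} [NonUnitalRing R] [StarRing R] {p q : R} (hp : IsProjElem p)
    (hq : IsProjElem q) (h : p * q = q) : IsProjElem (p - q) ∧ q * p = q := by
  have h' : q * p = q := by simpa [hp.1, hq.1] using congrArg star h
  refine ⟨⟨by simp [hp.1, hq.1], ?_⟩, h'⟩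
  rw [sub_mul, mul_sub, mul_sub, hp.2, h, h', hq.2, sub_self, sub_zero]

/-- An element whose initial projection is `p` satisfies `v * p = v`. -/
theorem mul_eq_self_of_star_mul_self {W : Type*} [NormedRing W] [StarRing W] [CStarRing W]
    {v p : W} (hp : IsProjElem p) (h : star v * v = p) : v * p = v := by
  rw [← sub_eq_zero, ← CStarRing.star_mul_self_eq_zero_iff]
  have h1 : star v * (v * p) = p := by rw [← mul_assoc, h, hp.2]
  rw [star_sub, star_mul, hp.1, sub_mul, mul_sub, mul_sub, mul_assoc, mul_assoc, h1, h, hp.2,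
    sub_self]

theorem mul_eq_self_of_mul_star_self {W : Type*} [NormedRing W] [StarRing W] [CStarRing W]
    {v p : W} (hp : IsProjElem p) (h : v * star v = p) : p * v = v := by
  have := mul_eq_self_of_star_mul_self (v := star v) hp (by simpa using h)
  simpa [hp.1] using congrArg star this

theorem MvNEquiv.symm {R : Type*} [Mul R] [InvolutiveStar R] {p q : R} (h : MvNEquiv p q) :
    MvNEquiv q p := by
  obtain ⟨v, h1, h2⟩ := h
  exact ⟨star v, by simpa using h2, by simpa using h1⟩

theorem MvNEquiv.trans {R : Type*} [NonUnitalRing R] [StarRing R] {p q r : R}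
    (hp : IsProjElem p) (hr : IsProjElem r) (h : MvNEquiv p q) (h' : MvNEquiv q r) :
    MvNEquiv p r := by
  obtain ⟨v, rfl, rfl⟩ := h
  obtain ⟨w, h1, rfl⟩ := h'
  refine ⟨w * v, ?_, ?_⟩
  · rw [star_mul, mul_assoc, ← mul_assoc (star w), h1, mul_assoc, ← mul_assoc, hp.2]
  · rw [star_mul, mul_assoc, ← mul_assoc v, ← h1, mul_assoc, ← mul_assoc, hr.2]

/-- A nonzero projection whose corner consists of scalars. -/
def IsMinProj {A : Type*} [Ring A] [StarRing A] [Algebra ℂ A] (p : A) : Prop :=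
  IsProjElem p ∧ p ≠ 0 ∧ ∀ a : A, ∃ c : ℂ, p * a * p = c • p

/-- Minimal projections connected by a nonzero element are equivalent. -/
theorem IsMinProj.mvnEquiv {A : Type*} [CStarAlgebra A] {p q : A} (hp : IsMinProj p)
    (hq : IsMinProj q) {a : A} (ha : p * a * q ≠ 0) : MvNEquiv q p := by
  set x := p * a * q with hx
  have hxq : x * q = x := by rw [hx, mul_assoc, hq.1.2]
  have hpx : p * x = x := by rw [hx, ← mul_assoc, ← mul_assoc, hp.1.2]
  obtain ⟨c, hc⟩ : ∃ c : ℂ, star x * x = c • q := by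
    obtain ⟨c, hc⟩ := hq.2.2 (star x * x)
    refine ⟨c, ?_⟩
    rw [← hc]
    have : q * star x = star x := by simpa [hq.1.1] using congrArg star hxq
    rw [← mul_assoc q, this, mul_assoc, hxq]
  have hc0 : c ≠ 0 := by
    rintro rfl
    exact ha ((CStarRing.star_mul_self_eq_zero_iff _).1 (by rw [hc, zero_smul]))
  have hreal : (starRingEnd ℂ) c = c := by
    have h := congrArg star hc
    rw [star_mul, star_star, hc, star_smul, hq.1.1] at h
    exact (smul_left_injective ℂ hq.2.1 h).symm
  obtain ⟨r, rfl⟩ := Complex.conj_eq_iff_real.1 hreal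
  have hr : 0 ≤ r := by
    apply spectrum_star_mul_self_nonneg (b := x) r
    rw [hc, spectrum.mem_iff]
    intro hu
    refine hq.2.1 (smul_right_injective A hc0 ?_)
    change (r : ℂ) • q = (r : ℂ) • 0
    rw [smul_zero]
    have hz : (algebraMap ℝ A r - (r : ℂ) • q) * q = 0 := by
      rw [Algebra.algebraMap_eq_smul_one, sub_mul, smul_mul_assoc, smul_mul_assoc, hq.1.2, one_mul,
        Complex.coe_smul, sub_self]
    rw [hu.mul_right_eq_zero.1 hz, smul_zero]
  have hr' : 0 < r := lt_of_le_of_ne hr fun h => hc0 (by simp [← h])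
  set t : ℝ := (Real.sqrt r)⁻¹ with ht
  have htr : t * t * r = 1 := by
    rw [ht, ← mul_inv, Real.mul_self_sqrt hr, inv_mul_cancel₀ hr'.ne']
  set w : A := (t : ℂ) • x with hw
  have hww : star w * w = q := by
    rw [hw, star_smul, smul_mul_smul_comm, hc, smul_smul]
    have : star (t : ℂ) * t * r = 1 := by
      rw [Complex.star_def, Complex.conj_ofReal]
      exact_mod_cast htr
    rw [this, one_smul]
  have hwq : w * q = w := by rw [hw, smul_mul_assoc, hxq]
  refine ⟨w, hww, ?_⟩
  obtain ⟨d, hd⟩ := hp.2.2 (w * star w)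
  have hpw : p * w = w := by rw [hw, mul_smul_comm, hpx]
  have hwp : star w * p = star w := by simpa [hp.1.1] using congrArg star hpw
  rw [← mul_assoc, hpw, mul_assoc, hwp] at hd
  have hw0 : w * star w ≠ 0 := fun h0 => hq.2.1 <| by
    rw [CStarRing.mul_star_self_eq_zero_iff] at h0
    rw [← hww, h0, mul_zero]
  have hidem : w * star w * (w * star w) = w * star w := by
    rw [mul_assoc, ← mul_assoc (star w), hww, ← mul_assoc, hwq]
  rw [hd] at hidem hw0 ⊢
  rw [smul_mul_smul_comm, hp.1.2] at hidem
  have hdd : d * d = d := smul_left_injective ℂ hp.2.1 hidem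
  have hd0 : d ≠ 0 := fun h => hw0 (by simp [h])
  rw [mul_left_cancel₀ hd0 (hdd.trans (mul_one d).symm), one_smul]

section FiniteDimensional

variable {A : Type*} [CStarAlgebra A] [FiniteDimensional ℂ A]

theorem finite_real_spectrum (b : A) : (spectrum ℝ b).Finite := by
  cases subsingleton_or_nontrivial A
  · rw [spectrum.of_subsingleton]
    exact Set.finite_empty
  have : FiniteDimensional ℝ A := FiniteDimensional.complexToReal A
  have hb : IsIntegral ℝ b := IsIntegral.of_finite ℝ b
  refine (Polynomial.finite_setOfPred_isRoot (minpoly.ne_zero hb)).subset fun x hx => ?_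
  have := spectrum.subset_polynomial_aeval b (minpoly ℝ b) ⟨x, hx, rfl⟩
  simpa using this

/-- A projection without proper nonzero subprojections is minimal. -/
theorem isMinProj_of_unsplittable {e : A} (he : IsProjElem e) (he0 : e ≠ 0)
    (hmin : ∀ f : A, IsProjElem f → e * f = f → f = 0 ∨ f = e) : IsMinProj e := by
  classical
  have key : ∀ a : A, IsSelfAdjoint a → ∃ c : ℂ, e * a * e = c • e := by
    intro a ha
    set b := e * a * e with hbdef
    have hb : IsSelfAdjoint b := by
      simp [isSelfAdjoint_iff, hbdef, he.1, ha.star_eq, mul_assoc]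
    have hbe : b * e = b := by rw [hbdef, mul_assoc, he.2]
    have heb : e * b = b := by rw [hbdef, ← mul_assoc, ← mul_assoc, he.2]
    have hfin := finite_real_spectrum b
    have hc : ∀ f : ℝ → ℝ, ContinuousOn f (spectrum ℝ b) := fun f => hfin.continuousOn f
    let g : ℝ → A := fun x => cfc (fun y => if y = x then (1 : ℝ) else 0) b
    have hsum : ∑ x ∈ hfin.toFinset, g x = 1 := by
      rw [← cfc_sum _ _ _ (fun _ _ => hc _), ← cfc_one ℝ b]
      refine cfc_congr fun y hy => ?_
      simp [Finset.sum_apply, hy]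
    have hcomm : ∀ x, e * g x = g x * e := fun x =>
      ((show Commute b e from hbe.trans heb.symm).cfc_real _).symm.eq
    have hg : ∀ x, IsProjElem (g x) := fun x => by
      refine ⟨(cfc_predicate _ b : IsSelfAdjoint _).star_eq, ?_⟩
      rw [← cfc_mul _ _ b (hc _) (hc _)]
      refine cfc_congr fun y _ => ?_
      simp
    have hbg : ∀ x, b * g x = x • g x := fun x => by
      conv_lhs => rw [← cfc_id' ℝ b]
      rw [← cfc_mul _ _ _ (hc _) (hc _), ← cfc_smul _ _ _ (hc _)]
      refine cfc_congr fun y _ => ?_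
      by_cases h : y = x <;> simp [h]
    obtain ⟨x, hx⟩ : ∃ x, e * g x ≠ 0 := by
      by_contra! h
      apply he0
      rw [← mul_one e, ← hsum, Finset.mul_sum]
      exact Finset.sum_eq_zero fun x _ => h x
    have hxe : e * g x = e := by
      refine (hmin (e * g x) ⟨?_, ?_⟩ ?_).resolve_left hx
      · rw [star_mul, he.1, (hg x).1, hcomm]
      · rw [mul_assoc, ← mul_assoc (g x), ← hcomm, mul_assoc e, (hg x).2, ← mul_assoc, he.2]
      · rw [← mul_assoc, he.2]
    refine ⟨(x : ℂ), ?_⟩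
    rw [← hbe, ← hxe, hcomm, ← mul_assoc, hbg, smul_mul_assoc, ← Complex.coe_smul]
  refine ⟨he, he0, fun a => ?_⟩
  obtain ⟨c, hc⟩ := key _ (realPart a).2
  obtain ⟨d, hd⟩ := key _ (imaginaryPart a).2
  refine ⟨c + Complex.I * d, ?_⟩
  conv_lhs => rw [← realPart_add_I_smul_imaginaryPart a]
  rw [mul_add, add_mul, hc, mul_smul_comm, smul_mul_assoc, hd, add_smul, mul_smul]

/-- Proper subprojections generate smaller right ideals. -/
theorem finrank_range_mulLeft_lt {p e : A} (hp : IsProjElem p) (he : IsProjElem e)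
    (h : p * e = e) (hne : e ≠ p) :
    Module.finrank ℂ (LinearMap.mulLeft ℂ e).range <
      Module.finrank ℂ (LinearMap.mulLeft ℂ p).range := by
  refine Submodule.finrank_lt_finrank_of_lt (lt_of_le_of_ne ?_ ?_)
  · rintro _ ⟨x, rfl⟩
    exact ⟨e * x, by simp [← mul_assoc, h]⟩
  · intro heq
    obtain ⟨x, hx⟩ : p ∈ (LinearMap.mulLeft ℂ e).range := heq ▸ ⟨1, by simp⟩
    have : e * p = p := by rw [← hx]; simp [← mul_assoc, he.2]
    exact hne ((hp.sub he h).2.symm.trans this)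

theorem exists_isMinProj_le {p : A} (hp : IsProjElem p) (hp0 : p ≠ 0) :
    ∃ q, IsMinProj q ∧ p * q = q := by
  induction hn : Module.finrank ℂ (LinearMap.mulLeft ℂ p).range using Nat.strong_induction_on
    generalizing p with
  | _ n ih =>
    subst hn
    by_cases h : ∀ f : A, IsProjElem f → p * f = f → f = 0 ∨ f = p
    · exact ⟨p, isMinProj_of_unsplittable hp hp0 h, hp.2⟩
    · push Not at h
      obtain ⟨f, hf, hpf, hf0, hfp⟩ := h
      obtain ⟨q, hq, hfq⟩ := ih _ (finrank_range_mulLeft_lt hp hf hpf hfp) hf hf0 rfl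
      exact ⟨q, hq, by rw [← hfq, ← mul_assoc, hpf]⟩

/-- Every projection is a finite sum of pairwise orthogonal minimal projections. -/
theorem exists_sum_isMinProj {p : A} (hp : IsProjElem p) :
    ∃ S : Finset A, (∀ q ∈ S, IsMinProj q) ∧ (∀ q ∈ S, ∀ r ∈ S, q ≠ r → q * r = 0) ∧
      ∑ q ∈ S, q = p := by
  classical
  induction hn : Module.finrank ℂ (LinearMap.mulLeft ℂ p).range using Nat.strong_induction_on
    generalizing p with
  | _ n ih =>
    subst hn
    by_cases hp0 : p = 0
    · exact ⟨∅, by simp, by simp, by simp [hp0]⟩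
    obtain ⟨q, hq, hpq⟩ := exists_isMinProj_le hp hp0
    obtain ⟨hr, hqp⟩ := hp.sub hq.1 hpq
    have hlt := finrank_range_mulLeft_lt hp hr (by rw [mul_sub, hp.2, hpq])
      (by simpa using hq.2.1)
    obtain ⟨S, hS, horth, hsum⟩ := ih _ hlt hr rfl
    have hqs : ∀ s ∈ S, q * s = 0 := by
      intro s hs
      have : (p - q) * s = s := by
        rw [← hsum, Finset.sum_mul, Finset.sum_eq_single s (fun r hr' hne => horth r hr' s hs hne)
          (fun h => absurd hs h), (hS s hs).1.2]
      rw [← this, ← mul_assoc, mul_sub, hqp, hq.1.2, sub_self, zero_mul]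
    have hsq : ∀ s ∈ S, s * q = 0 := fun s hs => by
      simpa [hq.1.1, (hS s hs).1.1] using congrArg star (hqs s hs)
    have hqS : q ∉ S := fun h => hq.2.1 (by rw [← hq.1.2, hqs q h])
    refine ⟨insert q S, ?_, ?_, ?_⟩
    · simpa using ⟨hq, hS⟩
    · intro s hs t ht hne
      rcases Finset.mem_insert.1 hs with hs | hs <;> rcases Finset.mem_insert.1 ht with ht | ht
      · exact absurd (hs.trans ht.symm) hne
      · exact hs ▸ hqs t ht
      · exact ht ▸ hsq s hs
      · exact horth s hs t ht hne
    · rw [Finset.sum_insert hqS, hsum, add_sub_cancel]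

variable (A) in
/-- A system of matrix units: partial isometries `w q` indexed by a finite set of projections with
sum `1`, whose initial projections `P q` are minimal, and equal as soon as they are connected. -/
theorem exists_matrixUnits :
    ∃ (S : Finset A) (P w : A → A), ∑ q ∈ S, w q * star (w q) = 1 ∧
      (∀ q ∈ S, IsProjElem (P q) ∧ star (w q) * w q = P q) ∧
      (∀ q ∈ S, ∀ r ∈ S, q ≠ r → star (w q) * w r = 0) ∧
      ∀ q ∈ S, ∀ r ∈ S, ∀ a : A, ∃ c : ℂ, star (w q) * a * w r = c • P q ∧ (P q = P r ∨ c = 0) := by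
  classical
  obtain ⟨S, hS, horth, hsum⟩ := exists_sum_isMinProj (A := A) (p := 1) ⟨star_one A, mul_one 1⟩
  let s : Setoid {q : A // IsMinProj q} :=
    { r := fun p q => MvNEquiv p.1 q.1
      iseqv :=
        { refl := fun p => ⟨p.1, by rw [p.2.1.1, p.2.1.2], by rw [p.2.1.1, p.2.1.2]⟩
          symm := fun h => h.symm
          trans := fun {p _ r} h h' => h.trans p.2.1 r.2.1 h' } }
  let rep : {q : A // IsMinProj q} → {q : A // IsMinProj q} := fun q => (Quotient.mk s q).out
  have hrep : ∀ q, MvNEquiv (rep q).1 q.1 := fun q =>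
    Quotient.exact (s := s) (Quotient.out_eq (Quotient.mk s q))
  have hrep' : ∀ q r, MvNEquiv (rep q).1 (rep r).1 → rep q = rep r := fun q r h => by
    have : Quotient.mk s (rep q) = Quotient.mk s (rep r) := Quotient.sound h
    simp only [rep, Quotient.out_eq] at this
    simp only [rep, this]
  choose v hv1 hv2 using hrep
  let P : A → A := fun q => if h : IsMinProj q then (rep ⟨q, h⟩).1 else 0
  let w : A → A := fun q => if h : IsMinProj q then v ⟨q, h⟩ else 0
  have hP : ∀ q ∈ S, IsMinProj (P q) := fun q hq => by
    simp only [P, dif_pos (hS q hq)]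
    exact (rep _).2
  have hw1 : ∀ q ∈ S, star (w q) * w q = P q := fun q hq => by
    simp only [P, w, dif_pos (hS q hq), hv1]
  have hw2 : ∀ q ∈ S, w q * star (w q) = q := fun q hq => by
    simp only [w, dif_pos (hS q hq), hv2]
  have hPP : ∀ q ∈ S, ∀ r ∈ S, MvNEquiv (P q) (P r) → P q = P r := fun q hq r hr h => by
    simp only [P, dif_pos (hS q hq), dif_pos (hS r hr)] at h ⊢
    rw [hrep' _ _ h]
  have hqw : ∀ q ∈ S, q * w q = w q := fun q hq =>
    mul_eq_self_of_mul_star_self (hS q hq).1 (hw2 q hq)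
  have hwq : ∀ q ∈ S, star (w q) * q = star (w q) := fun q hq => by
    simpa [(hS q hq).1.1] using congrArg star (hqw q hq)
  have hwP : ∀ q ∈ S, w q * P q = w q := fun q hq =>
    mul_eq_self_of_star_mul_self (hP q hq).1 (hw1 q hq)
  have hPw : ∀ q ∈ S, P q * star (w q) = star (w q) := fun q hq => by
    simpa [(hP q hq).1.1] using congrArg star (hwP q hq)
  refine ⟨S, P, w, ?_, fun q hq => ⟨(hP q hq).1, hw1 q hq⟩, ?_, ?_⟩
  · rw [Finset.sum_congr rfl hw2, hsum]
  · intro q hq r hr hne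
    rw [← hwq q hq, ← hqw r hr, mul_assoc, ← mul_assoc q, horth q hq r hr hne, zero_mul, mul_zero]
  · intro q hq r hr a
    have heq : P q * (star (w q) * a * w r) * P r = star (w q) * a * w r := by
      rw [← mul_assoc, ← mul_assoc, hPw q hq, mul_assoc, hwP r hr]
    by_cases h : P q = P r
    · obtain ⟨c, hc⟩ := (hP q hq).2.2 (star (w q) * a * w r)
      exact ⟨c, by rw [← heq, ← h, hc], Or.inl h⟩
    · refine ⟨0, ?_, Or.inr rfl⟩
      rw [zero_smul, ← heq]
      by_contra h0
      exact h (hPP q hq r hr ((hP q hq).mvnEquiv (hP r hr) h0).symm)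

/-- Unital *-homomorphisms of a finite-dimensional C*-algebra that agree on projections up to
Murray-von Neumann equivalence are unitarily equivalent. -/
theorem exists_unitary_intertwining {W : Type*} [CStarAlgebra W] (π ρ : A →⋆ₐ[ℂ] W)
    (h : ∀ p : A, IsProjElem p → MvNEquiv (π p) (ρ p)) :
    ∃ U ∈ unitary W, ∀ a, U * π a = ρ a * U := by
  classical
  obtain ⟨S, P, w, hsum, hP, horth, hcon⟩ := exists_matrixUnits A
  choose! v hv1 hv2 using h
  have hproj : ∀ (φ : A →⋆ₐ[ℂ] W) {p : A}, IsProjElem p → IsProjElem (φ p) := fun φ p hp =>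
    ⟨by rw [← map_star, hp.1], by rw [← map_mul, hp.2]⟩
  have hvπ : ∀ p, IsProjElem p → v p * π p = v p := fun p hp =>
    mul_eq_self_of_star_mul_self (hproj π hp) (hv1 p hp)
  have hρv : ∀ p, IsProjElem p → ρ p * v p = v p := fun p hp =>
    mul_eq_self_of_mul_star_self (hproj ρ hp) (hv2 p hp)
  have hwP : ∀ q ∈ S, w q * P q = w q := fun q hq =>
    mul_eq_self_of_star_mul_self (hP q hq).1 (hP q hq).2
  let U : W := ∑ q ∈ S, ρ (w q) * v (P q) * π (star (w q))
  have hstar : star U = ∑ q ∈ S, π (w q) * star (v (P q)) * ρ (star (w q)) := by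
    simp [U, star_sum, map_star, mul_assoc]
  refine ⟨U, ⟨?_, ?_⟩, fun a => ?_⟩
  · rw [hstar, Finset.sum_mul, ← map_one π, ← hsum, map_sum]
    refine Finset.sum_congr rfl fun q hq => ?_
    simp only [U, Finset.mul_sum]
    rw [Finset.sum_eq_single q]
    · calc π (w q) * star (v (P q)) * ρ (star (w q)) * (ρ (w q) * v (P q) * π (star (w q)))
          = π (w q) * star (v (P q)) * (ρ (star (w q) * w q) * v (P q)) * π (star (w q)) := by
            simp only [map_mul, mul_assoc]
        _ = π (w q) * (star (v (P q)) * v (P q)) * π (star (w q)) := by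
            rw [(hP q hq).2, hρv _ (hP q hq).1]; simp only [mul_assoc]
        _ = π (w q * star (w q)) := by
            rw [hv1 _ (hP q hq).1, ← map_mul, hwP q hq, map_mul]
    · intro r hr hne
      calc π (w q) * star (v (P q)) * ρ (star (w q)) * (ρ (w r) * v (P r) * π (star (w r)))
          = π (w q) * star (v (P q)) * ρ (star (w q) * w r) * v (P r) * π (star (w r)) := by
            simp only [map_mul, mul_assoc]
        _ = 0 := by rw [horth q hq r hr hne.symm]; simp
    · exact fun h => absurd hq h
  · rw [hstar, Finset.mul_sum, ← map_one ρ, ← hsum, map_sum]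
    refine Finset.sum_congr rfl fun q hq => ?_
    simp only [U, Finset.sum_mul]
    rw [Finset.sum_eq_single q]
    · calc ρ (w q) * v (P q) * π (star (w q)) * (π (w q) * star (v (P q)) * ρ (star (w q)))
          = ρ (w q) * (v (P q) * π (star (w q) * w q)) * star (v (P q)) * ρ (star (w q)) := by
            simp only [map_mul, mul_assoc]
        _ = ρ (w q) * (v (P q) * star (v (P q))) * ρ (star (w q)) := by
            rw [(hP q hq).2, hvπ _ (hP q hq).1]; simp only [mul_assoc]
        _ = ρ (w q * star (w q)) := by
            rw [hv2 _ (hP q hq).1, ← map_mul, hwP q hq, map_mul]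
    · intro r hr hne
      calc ρ (w r) * v (P r) * π (star (w r)) * (π (w q) * star (v (P q)) * ρ (star (w q)))
          = ρ (w r) * v (P r) * π (star (w r) * w q) * star (v (P q)) * ρ (star (w q)) := by
            simp only [map_mul, mul_assoc]
        _ = 0 := by rw [horth r hr q hq hne]; simp
    · exact fun h => absurd hq h
  · have hl : U * π a =
        ∑ q ∈ S, ∑ r ∈ S, ρ (w q) * v (P q) * π (star (w q) * a * w r) * π (star (w r)) := by
      conv_lhs => rw [← mul_one a, ← hsum]
      simp only [U, Finset.sum_mul, Finset.mul_sum, map_sum, map_mul, mul_assoc]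
      exact Finset.sum_comm
    have hr : ρ a * U =
        ∑ q ∈ S, ∑ r ∈ S, ρ (w q) * ρ (star (w q) * a * w r) * v (P r) * π (star (w r)) := by
      conv_lhs => rw [← one_mul a, ← hsum]
      simp only [U, Finset.sum_mul, Finset.mul_sum, map_sum, map_mul, mul_assoc]
      exact Finset.sum_comm
    rw [hl, hr]
    refine Finset.sum_congr rfl fun q hq => Finset.sum_congr rfl fun r hr => ?_
    obtain ⟨c, hc, hPc⟩ := hcon q hq r hr a
    rw [hc]
    rcases hPc with hPq | rfl
    · rw [map_smul, map_smul, mul_smul_comm, mul_smul_comm, mul_assoc (ρ (w q)) (v (P q)),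
        hvπ _ (hP q hq).1, smul_mul_assoc (c) (ρ (w q) * ρ (P q)), mul_assoc (ρ (w q)) (ρ (P q)),
        ← hPq, hρv _ (hP q hq).1]
    · simp

end FiniteDimensional

/-- Approximate unitary equivalence on a finite set, up to a given tolerance. -/
theorem IsLF.exists_unitary_norm_lt {B W : Type*} [CStarAlgebra B] [CStarAlgebra W]
    (hLF : IsLF B) (π ρ : B →⋆ₐ[ℂ] W)
    (h : ∀ p : B, IsProjElem p → MvNEquiv (π p) (ρ p)) (F : Finset B) {ε : ℝ} (hε : 0 < ε) :
    ∃ U ∈ unitary W, ∀ b ∈ F, ‖U * π b * star U - ρ b‖ < ε := by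
  obtain ⟨D, hD, happrox⟩ := hLF F (ε / 2) (half_pos hε)
  have : IsClosed (D : Set B) := Submodule.closed_of_finiteDimensional D.toSubalgebra.toSubmodule
  obtain ⟨U, hU, hint⟩ := exists_unitary_intertwining (π.comp D.subtype) (ρ.comp D.subtype)
    fun p hp => h p ⟨congrArg Subtype.val hp.1, congrArg Subtype.val hp.2⟩
  refine ⟨U, hU, fun b hb => ?_⟩
  obtain ⟨d, hd, hbd⟩ := happrox b hb
  have hUd : U * π d * star U = ρ d := by
    have : U * π d = ρ d * U := hint ⟨d, hd⟩
    rw [this, mul_assoc, Unitary.mul_star_self_of_mem hU, mul_one]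
  have hdecomp : U * π b * star U - ρ b = U * π (b - d) * star U - ρ (b - d) := by
    rw [map_sub, map_sub, mul_sub, sub_mul, hUd]
    abel
  have h1 : ‖U * π (b - d) * star U‖ = ‖π (b - d)‖ := by
    rw [CStarRing.norm_mul_mem_unitary _ (Unitary.star_mem hU), CStarRing.norm_mem_unitary_mul _ hU]
  calc ‖U * π b * star U - ρ b‖ ≤ ‖π (b - d)‖ + ‖ρ (b - d)‖ := by
        rw [hdecomp, ← h1]
        exact norm_sub_le _ _
    _ ≤ ‖b - d‖ + ‖b - d‖ :=
        add_le_add (NonUnitalStarAlgHom.norm_apply_le π _) (NonUnitalStarAlgHom.norm_apply_le ρ _)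
    _ < ε := by linarith

theorem stmt1 {B : Type u} {W : Type v}
    [NormedRing B] [StarRing B] [CStarRing B] [NormedAlgebra ℂ B] [StarModule ℂ B]
    [CompleteSpace B]
    [NormedRing W] [StarRing W] [CStarRing W] [NormedAlgebra ℂ W] [StarModule ℂ W]
    [CompleteSpace W]
    (hLF : IsLF B) (π ρ : B →⋆ₐ[ℂ] W)
    (h : ∀ p : B, IsProjElem p → MvNEquiv (π p) (ρ p)) :
    ApproxUnitEquiv (fun b => π b) (fun b => ρ b) := by
  classical
  let _ : CStarAlgebra B := {}
  let _ : CStarAlgebra W := {}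
  choose U hU hUF using fun x : Finset B × ℕ =>
    hLF.exists_unitary_norm_lt π ρ h x.1 (Nat.one_div_pos_of_nat (α := ℝ) (n := x.2))
  refine ⟨ULift.{v} (Finset B × ℕ), Filter.atTop.map ULift.up, inferInstance, fun i => U i.down,
    fun i => ⟨(hU i.down).1, (hU i.down).2⟩, fun b => ?_⟩
  rw [Filter.tendsto_map'_iff]
  have hlim : Filter.Tendsto (fun x : Finset B × ℕ => 1 / ((x.2 : ℝ) + 1)) Filter.atTop (nhds 0) :=
    tendsto_one_div_add_atTop_nhds_zero_nat.comp
      (Filter.prod_atTop_atTop_eq (α := Finset B) (β := ℕ) ▸ Filter.tendsto_snd)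
  refine squeeze_zero' (Filter.Eventually.of_forall fun _ => norm_nonneg _) ?_ hlim
  filter_upwards [Filter.eventually_ge_atTop (({b}, 0) : Finset B × ℕ)] with x hx
  exact (hUF x b (hx.1 (Finset.mem_singleton_self b))).le
end

section
/- Let J be a norm-closed two-sided ideal in a von Neumann algebra M, J_0 the ideal of M generated by the projections in J, A a C*-algebra, and π : A → M a unital *-homomorphism. Then the norm closure of π^{-1}(J_0) equals π^{-1}(J). -/
/-!
Statement 6: Let `J` be a norm-closed two-sided ideal in a von Neumann algebra `M`, `J₀` the
ideal of `M` generated by the projections in `J`, `A` a C*-algebra and `π : A → M` a unital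
*-homomorphism.  Then the norm closure of `π⁻¹(J₀)` equals `π⁻¹(J)`.
-/

noncomputable section

/-- `I` is a two-sided ideal of the algebra (given as the subset) `Mset`. -/
def IsIdealOf {R : Type*} [NonUnitalNonAssocSemiring R] (Mset I : Set R) : Prop :=
  I ⊆ Mset ∧ (0 : R) ∈ I ∧ (∀ x ∈ I, ∀ y ∈ I, x + y ∈ I) ∧
    ∀ x ∈ I, ∀ m ∈ Mset, m * x ∈ I ∧ x * m ∈ I

/-- The two-sided ideal of `Mset` generated by the subset `S`. -/
def idealGenBy {R : Type*} [NonUnitalNonAssocSemiring R] (Mset S : Set R) : Set R :=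
  ⋂₀ {I : Set R | IsIdealOf Mset I ∧ S ⊆ I}

/-- The ideal generated by a set contains the set. -/
theorem subset_idealGenBy {R : Type*} [NonUnitalNonAssocSemiring R] (Mset S : Set R) :
    S ⊆ idealGenBy Mset S :=
  fun _ hx _ hI => hI.2 hx

/-- The generated ideal is the smallest ideal containing the generators. -/
theorem idealGenBy_subset {R : Type*} [NonUnitalNonAssocSemiring R] {Mset S I : Set R}
    (hI : IsIdealOf Mset I) (hS : S ⊆ I) : idealGenBy Mset S ⊆ I :=
  fun _ hx => hx I ⟨hI, hS⟩

theorem mul_mem_idealGenBy {R : Type*} [NonUnitalNonAssocSemiring R] {Mset S : Set R} {x m : R}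
    (hx : x ∈ idealGenBy Mset S) (hm : m ∈ Mset) :
    m * x ∈ idealGenBy Mset S ∧ x * m ∈ idealGenBy Mset S :=
  ⟨fun I hI => (hI.1.2.2.2 x (hx I hI) m hm).1, fun I hI => (hI.1.2.2.2 x (hx I hI) m hm).2⟩

/-- An element `a` of a C*-algebra is approximated by elements `a * g` where `g` is supported away
from the kernel of `star a * a`, in the sense that `star a * a` is left invertible on `g`. -/
theorem exists_norm_sub_mul_sq_le {A : Type*} [CStarAlgebra A] (a : A) {ε : ℝ} (hε : 0 < ε) :
    ∃ g l : A, l * (star a * a) * g = g ∧ ‖a - a * g‖ ^ 2 ≤ 2 * ε := by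
  set b := star a * a with hb
  have hbsa : IsSelfAdjoint b := IsSelfAdjoint.star_mul_self a
  let γ : ℝ → ℝ := fun t => min 1 (max 0 (t / ε - 1))
  let lam : ℝ → ℝ := fun t => (max t ε)⁻¹
  have hγ : Continuous γ := by fun_prop
  have hlam : Continuous lam :=
    (continuous_id.max continuous_const).inv₀ fun t => (lt_max_of_lt_right hε).ne'
  have hγ0 : ∀ t, t ≤ ε → γ t = 0 := fun t ht => by
    have : t / ε ≤ 1 := (div_le_one hε).2 ht
    simp [γ, this]
  refine ⟨cfc γ b, cfc lam b, ?_, ?_⟩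
  · have h : cfc (fun t => lam t * t * γ t) b = cfc lam b * b * cfc γ b := by
      rw [cfc_mul (fun t => lam t * t) γ b (by fun_prop) (by fun_prop),
        cfc_mul lam (fun t => t) b (by fun_prop) (by fun_prop), cfc_id' ℝ b]
    rw [← h]
    congr 1
    funext t
    rcases le_total t ε with ht | ht
    · simp [hγ0 t ht]
    · have : t ≠ 0 := (hε.trans_le ht).ne'
      simp [lam, max_eq_left ht, this]
  · have hsub : cfc (fun t => 1 - γ t) b = 1 - cfc γ b := by
      rw [cfc_sub (fun _ => (1 : ℝ)) γ b (by fun_prop) (by fun_prop), cfc_const_one ℝ b]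
    have hsa : star (1 - cfc γ b) = 1 - cfc γ b := by
      rw [← hsub]
      exact (cfc_predicate (fun t => 1 - γ t) b : IsSelfAdjoint _)
    have h : cfc (fun t => (1 - γ t) * t * (1 - γ t)) b =
        (1 - cfc γ b) * b * (1 - cfc γ b) := by
      rw [cfc_mul (fun t => (1 - γ t) * t) (fun t => 1 - γ t) b (by fun_prop) (by fun_prop),
        cfc_mul (fun t => 1 - γ t) (fun t => t) b (by fun_prop) (by fun_prop), cfc_id' ℝ b, hsub]
    have hnorm : ‖a - a * cfc γ b‖ ^ 2 = ‖(1 - cfc γ b) * b * (1 - cfc γ b)‖ := by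
      rw [sq, ← CStarRing.norm_star_mul_self, show a - a * cfc γ b = a * (1 - cfc γ b) by
        rw [mul_sub, mul_one], star_mul, hsa, hb]
      simp only [mul_assoc]
    rw [hnorm, ← h]
    refine norm_cfc_le (by positivity) fun t ht => ?_
    have ht0 : 0 ≤ t := spectrum_star_mul_self_nonneg t ht
    have h0 : 0 ≤ γ t := le_min zero_le_one (le_max_left _ _)
    have h1 : γ t ≤ 1 := min_le_left _ _
    rw [Real.norm_of_nonneg (mul_nonneg (mul_nonneg (by linarith) ht0) (by linarith))]
    rcases le_total t (2 * ε) with h2 | h2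
    · nlinarith [mul_nonneg ht0 h0, mul_nonneg (mul_nonneg ht0 h0) (sub_nonneg.2 h1)]
    · have : γ t = 1 := by
        have : 2 ≤ t / ε := (le_div_iff₀ hε).2 h2
        exact min_eq_left (le_max_of_le_right (by linarith))
      simp [this, hε.le]

/-- The projection onto the closure of the range of an element of a von Neumann algebra belongs
to that algebra. -/
theorem VonNeumannAlgebra.starProjection_closure_range_mem {H : Type*} [NormedAddCommGroup H]
    [InnerProductSpace ℂ H] [CompleteSpace H] (M : VonNeumannAlgebra H) {c : H →L[ℂ] H}
    (hc : c ∈ M) : c.range.topologicalClosure.starProjection ∈ M := by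
  rw [VonNeumannAlgebra.IsStarProjection.mem_iff isStarProjection_starProjection]
  intro y hy
  rw [Submodule.range_starProjection]
  refine Submodule.topologicalClosure_mem_invtSubmodule ?_
  rintro _ ⟨v, rfl⟩
  have h := congr($(VonNeumannAlgebra.mem_commutant_iff.1 hy c hc) v)
  exact ⟨y v, h⟩

/-- A continuous operator fixing the range of `c` fixes the projection onto the closure of that
range. -/
theorem mul_starProjection_closure_range_of_mul_eq {H : Type*} [NormedAddCommGroup H]
    [InnerProductSpace ℂ H] [CompleteSpace H] {z c : H →L[ℂ] H} (h : z * c = c) :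
    z * c.range.topologicalClosure.starProjection =
      c.range.topologicalClosure.starProjection := by
  have hfix : c.range.topologicalClosure ≤ (z - 1).ker := by
    refine Submodule.topologicalClosure_minimal _ ?_ (z - 1).isClosed_ker
    rintro _ ⟨v, rfl⟩
    have := congr($h v)
    simpa [sub_eq_zero] using this
  ext v
  have := hfix (Submodule.starProjection_apply_mem c.range.topologicalClosure v)
  simpa [sub_eq_zero] using this

theorem starProjection_closure_range_mul {H : Type*} [NormedAddCommGroup H]
    [InnerProductSpace ℂ H] [CompleteSpace H] (c : H →L[ℂ] H) :
    c.range.topologicalClosure.starProjection * c = c := by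
  ext v
  exact Submodule.starProjection_eq_self_iff.2
    (Submodule.le_topologicalClosure _ (LinearMap.mem_range_self _ v))

/-- If `x` in the ideal `J` of `M` is left invertible on `c ∈ M`, then `c` lies in the ideal
generated by the projections of `J`. -/
theorem mem_idealGenBy_projections_of_mul_eq {H : Type*} [NormedAddCommGroup H]
    [InnerProductSpace ℂ H] [CompleteSpace H] {M : VonNeumannAlgebra H} {J : Set (H →L[ℂ] H)}
    (hJ : IsIdealOf (M : Set (H →L[ℂ] H)) J) {l x c : H →L[ℂ] H} (hl : l ∈ M) (hx : x ∈ J)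
    (hc : c ∈ M) (h : l * x * c = c) :
    c ∈ idealGenBy (M : Set (H →L[ℂ] H)) {p | p ∈ J ∧ IsProjElem p} := by
  have hpM := M.starProjection_closure_range_mem hc
  have hp := isStarProjection_starProjection (U := c.range.topologicalClosure)
  have hpJ : c.range.topologicalClosure.starProjection ∈ J := by
    rw [← mul_starProjection_closure_range_of_mul_eq h]
    exact (hJ.2.2.2 _ (hJ.2.2.2 x hx l hl).1 _ hpM).2
  rw [← starProjection_closure_range_mul c]
  refine (mul_mem_idealGenBy (subset_idealGenBy _ _ ?_) hc).2
  exact ⟨hpJ, hp.isSelfAdjoint.star_eq, hp.isIdempotentElem.eq⟩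

theorem stmt6 {H : Type*} [NormedAddCommGroup H] [InnerProductSpace ℂ H] [CompleteSpace H]
    {A : Type*} [NormedRing A] [StarRing A] [CStarRing A] [NormedAlgebra ℂ A]
    [StarModule ℂ A] [CompleteSpace A]
    (M : VonNeumannAlgebra H) (J : Set (H →L[ℂ] H))
    (hJ : IsIdealOf (M : Set (H →L[ℂ] H)) J) (hJclosed : IsClosed J)
    (J₀ : Set (H →L[ℂ] H))
    (hJ₀ : J₀ = idealGenBy (M : Set (H →L[ℂ] H)) {p | p ∈ J ∧ IsProjElem p})
    (π : A →⋆ₐ[ℂ] (H →L[ℂ] H)) (hπM : ∀ a : A, π a ∈ M) :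
    closure ((fun a : A => π a) ⁻¹' J₀) = (fun a : A => π a) ⁻¹' J := by
  let _ : CStarAlgebra A := {}
  have hJ₀J : J₀ ⊆ J := hJ₀ ▸ idealGenBy_subset hJ fun p hp => hp.1
  have hπ : Continuous π := by
    open scoped CStarAlgebra in exact map_continuous π
  refine (closure_minimal (Set.preimage_mono hJ₀J) (hJclosed.preimage hπ)).antisymm fun a ha => ?_
  rw [Metric.mem_closure_iff]
  intro δ hδ
  obtain ⟨g, l, hlg, hnorm⟩ := exists_norm_sub_mul_sq_le a (ε := δ ^ 2 / 4) (by positivity)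
  refine ⟨a * g, ?_, ?_⟩
  · have hx : π (star a * a) ∈ J := by
      rw [map_mul]
      exact (hJ.2.2.2 _ ha _ (hπM (star a))).1
    have hg := mem_idealGenBy_projections_of_mul_eq hJ (hπM l) hx (hπM g)
      (by rw [← map_mul, ← map_mul, hlg])
    rw [Set.mem_preimage, map_mul, hJ₀]
    exact (mul_mem_idealGenBy hg (hπM a)).1
  · rw [dist_eq_norm]
    refine lt_of_pow_lt_pow_left₀ 2 hδ.le (hnorm.trans_lt ?_)
    nlinarith [sq_pos_of_pos hδ]

end
end

section
/- If {A_λ} is an increasingly directed family of subhomogeneous C*-subalgebras of a C*-algebra A and A is the norm closure of ∪_λ A_λ (so A is ASH), then A ⊂ (∪_λ A_λ^{##})^{−‖·‖} ⊂ A^{##} and the norm closure (∪_λ A_λ^{##})^{−‖·‖} is an LF C*-algebra; in particular, every ASH C*-algebra is strongly LF-embeddable. -/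
/-!
Statement 17: If `{A_λ}` is an increasingly directed family of subhomogeneous
C*-subalgebras of a C*-algebra `A` and `A` is the norm closure of `⋃_λ A_λ` (so `A` is ASH),
then `A ⊆ (⋃_λ A_λ^{##})^{-‖·‖} ⊆ A^{##}` and the norm closure `(⋃_λ A_λ^{##})^{-‖·‖}` is an
LF C*-algebra; in particular every ASH C*-algebra is strongly LF-embeddable (there is an LF
C*-algebra `B` with `A ⊆ B ⊆ A^{##}`).

Here `A` is realized concretely (e.g. via its universal representation) as a closed star
subalgebra `𝒜` of `B(K)`, and the biduals are realized as double commutants.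
-/

noncomputable section

variable {K : Type*} [NormedAddCommGroup K] [InnerProductSpace ℂ K] [CompleteSpace K]

/-- The double commutant of a star subalgebra of `B(K)`; for a C*-subalgebra in its
universal representation this realizes its second dual (enveloping von Neumann algebra). -/
def bidualIn (S : StarSubalgebra ℂ (K →L[ℂ] K)) : StarSubalgebra ℂ (K →L[ℂ] K) :=
  StarSubalgebra.centralizer ℂ
    ((StarSubalgebra.centralizer ℂ (S : Set (K →L[ℂ] K))) : Set (K →L[ℂ] K))

/-- A (sub)algebra `D` is subhomogeneous if there is a uniform bound `N` such that every
nilpotent element `x` of `D` satisfies `x ^ N = 0` (equivalently, every representation of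
`D` is on a Hilbert space of dimension at most `N`). -/
def IsSubhomogeneous {A : Type*} [NormedRing A] [StarRing A] [NormedAlgebra ℂ A]
    [StarModule ℂ A] (D : StarSubalgebra ℂ A) : Prop :=
  ∃ N : ℕ, 0 < N ∧ ∀ x ∈ D, (∃ m : ℕ, 0 < m ∧ x ^ m = 0) → x ^ N = 0

/-- The subset `S` of `B(K)` is an LF C*-algebra: every finite subset of `S` can be
approximated within `ε` by elements of a finite-dimensional C*-subalgebra contained in
`S`. -/
def IsLFSet (S : Set (K →L[ℂ] K)) : Prop :=
  ∀ F : Finset (K →L[ℂ] K), (↑F : Set (K →L[ℂ] K)) ⊆ S → ∀ ε : ℝ, 0 < ε →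
    ∃ D : StarSubalgebra ℂ (K →L[ℂ] K), (D : Set (K →L[ℂ] K)) ⊆ S ∧
      FiniteDimensional ℂ D ∧ ∀ b ∈ F, ∃ d ∈ D, ‖b - d‖ < ε

open Submodule in
theorem commute_starProjection_of_invariant (W : Submodule ℂ K) [W.HasOrthogonalProjection]
    (t : K →L[ℂ] K) (h : ∀ ξ ∈ W, t ξ ∈ W) (h' : ∀ ξ ∈ W, (star t) ξ ∈ W) :
    Commute t W.starProjection := by
  ext ξ
  refine (eq_starProjection_of_mem_orthogonal' (z := t (ξ - W.starProjection ξ))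
    (h _ (starProjection_apply_mem W ξ)) ?_ ?_).symm
  · rw [Submodule.mem_orthogonal]
    intro u hu
    rw [← ContinuousLinearMap.adjoint_inner_left]
    exact (Submodule.mem_orthogonal _ _).1 (W.sub_starProjection_mem_orthogonal ξ) _ (h' u hu)
  · simp

/-- The projection onto the common kernel of a set of operators. -/
theorem exists_kerProjection (Y : Set (K →L[ℂ] K)) :
    ∃ r : K →L[ℂ] K, IsStarProjection r ∧ (∀ y ∈ Y, y * r = 0) ∧
      (∀ m : K →L[ℂ] K, (∀ y ∈ Y, y * m = 0) → r * m = m) ∧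
      ∀ t : K →L[ℂ] K, (∀ y ∈ Y, Commute t y) → (∀ y ∈ Y, Commute (star t) y) →
        Commute t r := by
  let W : Submodule ℂ K := ⨅ y ∈ Y, LinearMap.ker (y : K →ₗ[ℂ] K)
  have hW : ∀ ξ, ξ ∈ W ↔ ∀ y ∈ Y, y ξ = 0 := by simp [W]
  have hc : IsClosed (W : Set K) := by
    have : (W : Set K) = ⋂ y ∈ Y, {ξ | y ξ = 0} := by ext; simp [hW]
    rw [this]
    exact isClosed_biInter fun y _ => isClosed_eq y.continuous continuous_const
  have : CompleteSpace W := hc.completeSpace_coe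
  have inv : ∀ t : K →L[ℂ] K, (∀ y ∈ Y, Commute t y) → ∀ ξ ∈ W, t ξ ∈ W := by
    intro t ht ξ hξ
    rw [hW] at hξ ⊢
    intro y hy
    have := DFunLike.congr_fun (ht y hy).eq ξ
    change t (y ξ) = y (t ξ) at this
    rw [← this, hξ y hy, map_zero]
  refine ⟨W.starProjection, isStarProjection_starProjection, ?_, ?_, ?_⟩
  · intro y hy
    ext ξ
    exact (hW _).1 (W.starProjection_apply_mem ξ) y hy
  · intro m hm
    ext ξ
    refine Submodule.starProjection_eq_self_iff.2 ((hW _).2 fun y hy => ?_)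
    exact DFunLike.congr_fun (hm y hy) ξ
  · intro t h1 h2
    exact commute_starProjection_of_invariant W t (inv t h1) (inv _ h2)

/-- The range projection of a self-adjoint operator. -/
theorem exists_rangeProjection {g : K →L[ℂ] K} (hg : IsSelfAdjoint g) :
    ∃ q : K →L[ℂ] K, IsStarProjection q ∧ g * q = g ∧ q * g = g ∧ (∀ m, g * m = 0 → q * m = 0) ∧
      ∀ t, Commute t g → Commute t q := by
  obtain ⟨r, hr, h1, h2, h3⟩ := exists_kerProjection {g}
  simp only [Set.mem_singleton_iff, forall_eq] at h1 h2 h3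
  have hgq : g * (1 - r) = g := by rw [mul_sub, h1, mul_one, sub_zero]
  refine ⟨1 - r, hr.one_sub, hgq, ?_, ?_, ?_⟩
  · simpa [hg.star_eq, hr.isSelfAdjoint.star_eq] using congrArg star hgq
  · intro m hm
    rw [sub_mul, h2 m hm, one_mul, sub_self]
  · intro t ht
    have ht' : Commute (star t) g := by
      have := congrArg star ht.eq
      simp only [star_mul, hg.star_eq] at this
      exact this.symm
    exact (Commute.one_right t).sub_right (h3 t ht ht')

/-- The projections in the bicommutant of an operator. -/
def spectralProjections (h : K →L[ℂ] K) : Set (K →L[ℂ] K) :=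
  {r | IsStarProjection r ∧ ∀ t, Commute t h → Commute t r}

theorem exists_spectralProjection_halving {h : K →L[ℂ] K} (hh : IsSelfAdjoint h) {c : ℝ}
    (hc : ‖h‖ ≤ c) :
    ∃ r ∈ spectralProjections h, ‖h - (c / 2 : ℝ) • (2 • r - 1)‖ ≤ c / 2 := by
  have hc0 : 0 ≤ c := (norm_nonneg h).trans hc
  obtain ⟨r, hr, hgr, hrg, hker, hcomm⟩ :=
    exists_rangeProjection (g := h⁺) (CFC.posPart_nonneg h).isSelfAdjoint
  have hneg : r * h⁻ = 0 := hker _ (CFC.posPart_mul_negPart h)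
  have hneg' : h⁻ * r = 0 := by
    simpa [(CFC.negPart_nonneg h).isSelfAdjoint.star_eq, hr.isSelfAdjoint.star_eq] using
      congrArg star hneg
  refine ⟨r, ⟨hr, fun t ht => hcomm t ?_⟩, ?_⟩
  · rw [CFC.posPart_def, cfcₙ_eq_cfc]
    exact (ht.symm.cfc_real _).symm
  have hdec := CFC.posPart_sub_negPart h
  have hle : ∀ k : K →L[ℂ] K, 0 ≤ k → ‖k‖ ≤ ‖h‖ → 0 ≤ algebraMap ℝ (K →L[ℂ] K) c - k := by
    intro k hk hkn
    rw [sub_nonneg]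
    exact (CStarAlgebra.norm_le_iff_le_algebraMap k hc0 hk).1 (hkn.trans hc)
  have hp : 0 ≤ algebraMap ℝ (K →L[ℂ] K) c - h⁺ :=
    hle _ (CFC.posPart_nonneg h) (CStarAlgebra.norm_posPart_le h)
  have hn : 0 ≤ algebraMap ℝ (K →L[ℂ] K) c - h⁻ :=
    hle _ (CFC.negPart_nonneg h) (CStarAlgebra.norm_negPart_le h)
  have compress : ∀ s x : K →L[ℂ] K, s * s = s → s * x * s = x →
      s * (algebraMap ℝ (K →L[ℂ] K) c - x) * s = c • s - x := by
    intro s x hs hx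
    rw [mul_sub, sub_mul, hx, Algebra.algebraMap_eq_smul_one, mul_smul_comm, mul_one,
      smul_mul_assoc, hs]
  have e1 := compress (1 - r) h⁻ hr.one_sub.isIdempotentElem.eq
    (by rw [sub_mul, hneg, one_mul, sub_zero, mul_sub, hneg', mul_one, sub_zero])
  have e2 := compress r h⁺ hr.isIdempotentElem.eq (by rw [hrg, hgr])
  have p1 : 0 ≤ c • (1 - r) - h⁻ := by
    rw [← e1]
    exact hr.one_sub.isSelfAdjoint.conjugate_nonneg hn
  have p2 : 0 ≤ c • r - h⁺ := by
    rw [← e2]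
    exact hr.isSelfAdjoint.conjugate_nonneg hp
  set k := h - (c / 2 : ℝ) • (2 • r - 1) with hk
  have k1 : k + algebraMap ℝ (K →L[ℂ] K) (c / 2) = h⁺ + (c • (1 - r) - h⁻) := by
    rw [hk, Algebra.algebraMap_eq_smul_one]
    nth_rw 1 [← hdec]
    module
  have k2 : algebraMap ℝ (K →L[ℂ] K) (c / 2) - k = h⁻ + (c • r - h⁺) := by
    rw [hk, Algebra.algebraMap_eq_smul_one]
    nth_rw 1 [← hdec]
    module
  have q1 : -algebraMap ℝ (K →L[ℂ] K) (c / 2) ≤ k := by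
    rw [neg_le_iff_add_nonneg, k1]
    exact add_nonneg (CFC.posPart_nonneg h) p1
  have q2 : k ≤ algebraMap ℝ (K →L[ℂ] K) (c / 2) := by
    rw [← sub_nonneg, k2]
    exact add_nonneg (CFC.negPart_nonneg h) p2
  have ksa : IsSelfAdjoint k :=
    hh.sub (IsSelfAdjoint.smul (IsSelfAdjoint.all _)
      ((IsSelfAdjoint.smul (IsSelfAdjoint.all _) hr.isSelfAdjoint).sub (IsSelfAdjoint.one _)))
  by_cases hnt : Nontrivial (K →L[ℂ] K)
  · rcases CStarAlgebra.norm_or_neg_norm_mem_spectrum ksa with hs | hs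
    · exact (le_algebraMap_iff_spectrum_le ksa).1 q2 _ hs
    · have := (algebraMap_le_iff_le_spectrum ksa).1 (by rwa [map_neg] : algebraMap ℝ _ (-(c/2)) ≤ k) _ hs
      linarith
  · rw [not_nontrivial_iff_subsingleton] at hnt
    rw [Subsingleton.elim k 0, norm_zero]
    positivity

theorem spectralProjections_mono {h k : K →L[ℂ] K} (H : ∀ t, Commute t h → Commute t k) :
    spectralProjections k ⊆ spectralProjections h :=
  fun _ hr => ⟨hr.1, fun t ht => hr.2 t (H t ht)⟩

theorem commute_of_mem_span_spectralProjections {h q t : K →L[ℂ] K}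
    (hq : q ∈ Submodule.span ℂ (spectralProjections h)) (ht : Commute t h) : Commute t q := by
  induction hq using Submodule.span_induction with
  | mem r hr => exact hr.2 t ht
  | zero => exact Commute.zero_right t
  | add x y _ _ hx hy => exact hx.add_right hy
  | smul a x _ hx => exact hx.smul_right a

theorem mem_closure_span_spectralProjections {h : K →L[ℂ] K} (hh : IsSelfAdjoint h) :
    h ∈ closure (Submodule.span ℂ (spectralProjections h) : Set (K →L[ℂ] K)) := by
  have key : ∀ n : ℕ, ∃ q ∈ Submodule.span ℂ (spectralProjections h),
      IsSelfAdjoint (h - q) ∧ ‖h - q‖ ≤ ‖h‖ / 2 ^ n := by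
    intro n
    induction n with
    | zero => exact ⟨0, zero_mem _, by simpa using hh, by simp⟩
    | succ n ih =>
      obtain ⟨q, hq, hsa, hn⟩ := ih
      obtain ⟨r, hr, hr'⟩ := exists_spectralProjection_halving hsa hn
      have hmono := spectralProjections_mono (h := h) (k := h - q) fun t ht =>
        ht.sub_right (commute_of_mem_span_spectralProjections hq ht)
      have h1 : (1 : K →L[ℂ] K) ∈ spectralProjections h :=
        ⟨.one _, fun t _ => Commute.one_right t⟩
      refine ⟨q + (‖h‖ / 2 ^ n / 2 : ℝ) • (2 • r - 1), ?_, ?_, ?_⟩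
      · refine add_mem hq ?_
        rw [← Complex.coe_smul]
        exact Submodule.smul_mem _ _ (sub_mem (nsmul_mem (Submodule.subset_span (hmono hr)) 2)
          (Submodule.subset_span h1))
      · rw [← sub_sub]
        exact hsa.sub (IsSelfAdjoint.smul (IsSelfAdjoint.all _)
          ((IsSelfAdjoint.smul (IsSelfAdjoint.all _) hr.1.isSelfAdjoint).sub (IsSelfAdjoint.one _)))
      · rw [← sub_sub, pow_succ, ← div_div]
        exact hr'
  rw [Metric.mem_closure_iff]
  intro ε hε
  have hlim : Filter.Tendsto (fun n : ℕ => ‖h‖ / 2 ^ n) Filter.atTop (nhds 0) := by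
    have := (tendsto_pow_atTop_nhds_zero_of_lt_one (r := (1 / 2 : ℝ)) (by norm_num)
      (by norm_num)).const_mul ‖h‖
    simpa [div_eq_mul_inv] using this
  obtain ⟨n, hn⟩ := (hlim.eventually (gt_mem_nhds hε)).exists
  obtain ⟨q, hq, -, hq'⟩ := key n
  exact ⟨q, hq, by rw [dist_eq_norm]; exact hq'.trans_lt hn⟩

/-- Cutting down the polar decomposition of `x` by a spectral projection of `|x|` gives a nonzero
partial isometry in the bicommutant of `x`. -/
theorem exists_partialIsometry {x : K →L[ℂ] K} (hx : x ≠ 0) :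
    ∃ y q : K →L[ℂ] K, IsStarProjection q ∧ q ≠ 0 ∧ star (x * y) * (x * y) = q ∧
      (∀ m, x * m = 0 → q * m = 0) ∧
      ∀ t, Commute t x → Commute t (star x) → Commute t y := by
  set a : K →L[ℂ] K := star x * x with ha
  have hasa : IsSelfAdjoint a := .star_mul_self x
  have hapos : 0 ≤ a := star_mul_self_nonneg x
  have hane : a ≠ 0 := by rwa [ha, Ne, CStarRing.star_mul_self_eq_zero_iff]
  have hnpos : 0 < ‖a‖ := norm_pos_iff.2 hane
  set c : ℝ := ‖a‖ / 2 with hc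
  have hcpos : 0 < c := by positivity
  have hmax : ∀ t : ℝ, 0 < max t c := fun t => lt_max_of_lt_right hcpos
  let l : ℝ → ℝ := fun t => max (t - c) 0
  let j : ℝ → ℝ := fun t => l t / max t c
  let f : ℝ → ℝ := fun t => (Real.sqrt (max t c))⁻¹
  let k : ℝ → ℝ := fun t => f t * t * f t
  have hl : Continuous l := by fun_prop
  have hj : Continuous j := hl.div (by fun_prop) fun t => (hmax t).ne'
  have hf : Continuous f :=
    Continuous.inv₀ (by fun_prop) fun t => (Real.sqrt_pos.2 (hmax t)).ne'
  have hk : Continuous k := by fun_prop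
  set g : K →L[ℂ] K := cfc l a with hg
  have hgsa : IsSelfAdjoint g := cfc_predicate l a
  have hcf : ∀ {u : ℝ → ℝ}, Continuous u → ContinuousOn u (spectrum ℝ a) :=
    fun hu => hu.continuousOn
  have hga : g = cfc j a * a := by
    have : cfc j a * a = cfc (fun t => j t * t) a := by
      rw [cfc_mul j (fun t => t) a (hcf hj), cfc_id' ℝ a]
    rw [this]
    refine cfc_congr fun t ht => ?_
    simp only [j, l]
    rcases le_total t c with h | h
    · rw [max_eq_right (by linarith)]; simp
    · rw [max_eq_left h, div_mul_cancel₀ _ (hcpos.trans_le h).ne']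
  obtain ⟨q, hq, hgq, hqg, hker, hcomm⟩ := exists_rangeProjection hgsa
  have hkill : ∀ m, x * m = 0 → q * m = 0 := by
    intro m hm
    refine hker m ?_
    rw [hga, ha, mul_assoc, mul_assoc, hm, mul_zero, mul_zero]
  have hfsa : IsSelfAdjoint (cfc f a) := cfc_predicate f a
  have hkeq : cfc f a * a * cfc f a = cfc k a := by
    rw [cfc_mul (fun t => f t * t) f a (hcf (by fun_prop)) (hcf hf),
      cfc_mul f (fun t => t) a (hcf hf), cfc_id' ℝ a]
  have hm0 : g * (1 - cfc k a) = 0 := by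
    have h1 : (1 : K →L[ℂ] K) = cfc (fun _ : ℝ => (1 : ℝ)) a := (cfc_const_one ℝ a).symm
    rw [h1, ← cfc_sub _ _ a (hcf continuous_const) (hcf hk), hg,
      ← cfc_mul _ _ a (hcf hl) (hcf (by fun_prop))]
    rw [← cfc_zero ℝ a]
    refine cfc_congr fun t _ => ?_
    simp only [l, k, f, Pi.zero_apply]
    rcases le_total t c with h | h
    · rw [max_eq_right (by linarith)]; simp
    · have h0 : 0 < t := hcpos.trans_le h
      have : (Real.sqrt t)⁻¹ * t * (Real.sqrt t)⁻¹ = 1 := by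
        have h2 := Real.sqrt_pos.2 h0
        field_simp
        rw [Real.sq_sqrt h0.le]
      rw [max_eq_left h, this]; simp
  have hqk : q * cfc k a = q := by
    have := hker _ hm0
    rw [mul_sub, mul_one, sub_eq_zero] at this
    exact this.symm
  refine ⟨cfc f a * q, q, hq, ?_, ?_, hkill, ?_⟩
  · rintro rfl
    rw [mul_zero] at hgq
    have hle : a ≤ algebraMap ℝ (K →L[ℂ] K) c := by
      rw [le_algebraMap_iff_spectrum_le hasa]
      intro t ht
      by_contra! hlt
      have h2 : l t ∈ spectrum ℝ g := by
        rw [hg, cfc_map_spectrum l a hasa (hcf hl)]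
        exact ⟨t, ht, rfl⟩
      have h3 : Nontrivial (K →L[ℂ] K) := ⟨a, 0, hane⟩
      rw [← hgq, spectrum.zero_eq, Set.mem_singleton_iff] at h2
      have : l t = t - c := max_eq_left (by linarith)
      linarith
    have := (CStarAlgebra.norm_le_iff_le_algebraMap a hcpos.le hapos).2 hle
    linarith
  · calc star (x * (cfc f a * q)) * (x * (cfc f a * q))
        = q * (cfc f a * (star x * x) * cfc f a) * q := by
          simp only [star_mul, hq.isSelfAdjoint.star_eq, hfsa.star_eq, mul_assoc]
      _ = q := by rw [← ha, hkeq, hqk, hq.isIdempotentElem.eq]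
  · intro t h1 h2
    have hta : Commute t a := h2.mul_right h1
    have htc : ∀ u : ℝ → ℝ, Commute t (cfc u a) := fun u => (hta.symm.cfc_real u).symm
    exact (htc f).mul_right (hcomm t (htc l))

/-- `M` contains every operator commuting with its commutant. -/
def IsBicommutantClosed (M : StarSubalgebra ℂ (K →L[ℂ] K)) : Prop :=
  ∀ x, (∀ t, (∀ m ∈ M, Commute t m) → Commute t x) → x ∈ M

theorem IsBicommutantClosed.exists_partialIsometry {M : StarSubalgebra ℂ (K →L[ℂ] K)}
    (hM : IsBicommutantClosed M) {x : K →L[ℂ] K} (hxM : x ∈ M) (hx : x ≠ 0) :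
    ∃ w ∈ M, IsStarProjection (star w * w) ∧ star w * w ≠ 0 ∧
      (∀ m, x * m = 0 → star w * w * m = 0) ∧ ∀ m, m * x = 0 → m * w = 0 := by
  obtain ⟨y, q, hq, hq0, hwq, hker, hcomm⟩ := _root_.exists_partialIsometry hx
  refine ⟨x * y, mul_mem hxM (hM y fun t ht => hcomm t (ht x hxM) (ht _ (star_mem hxM))),
    by rwa [hwq], by rwa [hwq], by rwa [hwq], fun m hm => by rw [← mul_assoc, hm, zero_mul]⟩

/-- The projections of `M` below `p`. -/
def cornerProjections (M : StarSubalgebra ℂ (K →L[ℂ] K)) (p : K →L[ℂ] K) : Set (K →L[ℂ] K) :=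
  {q | IsStarProjection q ∧ q ∈ M ∧ q * p = q ∧ p * q = q}

theorem IsBicommutantClosed.mem_closure_span_cornerProjections
    {M : StarSubalgebra ℂ (K →L[ℂ] K)} (hM : IsBicommutantClosed M) {p c : K →L[ℂ] K}
    (hp : IsStarProjection p) (hpM : p ∈ M) (hc : c ∈ M) (hpc : p * c = c) (hcp : c * p = c) :
    c ∈ (Submodule.span ℂ (cornerProjections M p)).topologicalClosure := by
  have sa : ∀ h ∈ M, IsSelfAdjoint h → p * h = h →
      h ∈ (Submodule.span ℂ (cornerProjections M p)).topologicalClosure := by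
    intro h hhM hh hph
    have hhp : h * p = h := by
      simpa [hh.star_eq, hp.isSelfAdjoint.star_eq] using congrArg star hph
    have h1 := mem_closure_span_spectralProjections hh
    have hcont : Continuous fun d : K →L[ℂ] K => d * p := by fun_prop
    have h2 := map_mem_closure hcont h1
      (t := (Submodule.span ℂ (cornerProjections M p) : Set (K →L[ℂ] K))) ?_
    · rw [hhp] at h2; exact h2
    · intro d hd
      simp only [SetLike.mem_coe] at hd ⊢
      induction hd using Submodule.span_induction with
      | mem r hr =>
        have hcomm : Commute p r := hr.2 p (by rw [Commute, SemiconjBy, hph, hhp])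
        have hrM : r ∈ M := hM r fun t ht => hr.2 t (ht h hhM)
        refine Submodule.subset_span ⟨hr.1.mul hp hcomm.symm, mul_mem hrM hpM, ?_, ?_⟩
        · rw [mul_assoc, hp.isIdempotentElem.eq]
        · rw [← mul_assoc, hcomm.eq, mul_assoc, hp.isIdempotentElem.eq]
      | zero => simp
      | add x y _ _ hx hy => rw [add_mul]; exact add_mem hx hy
      | smul a x _ hx => rw [smul_mul_assoc]; exact Submodule.smul_mem _ _ hx
  have hpc' : p * star c = star c := by
    simpa [hp.isSelfAdjoint.star_eq] using congrArg star hcp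
  have hre : (realPart c : K →L[ℂ] K) = (2 : ℝ)⁻¹ • (c + star c) := realPart_apply_coe c
  have him : (imaginaryPart c : K →L[ℂ] K) = -Complex.I • (2 : ℝ)⁻¹ • (c - star c) :=
    imaginaryPart_apply_coe c
  have smulM : ∀ (r : ℝ) (m : K →L[ℂ] K), m ∈ M → r • m ∈ M := fun r m hm => by
    rw [← Complex.coe_smul]; exact SMulMemClass.smul_mem _ hm
  rw [← realPart_add_I_smul_imaginaryPart c]
  refine add_mem (sa _ ?_ (realPart c).2 ?_) (Submodule.smul_mem _ _ (sa _ ?_ (imaginaryPart c).2 ?_))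
  · rw [hre]; exact smulM _ _ (add_mem hc (star_mem hc))
  · rw [hre, mul_smul_comm, mul_add, hpc, hpc']
  · rw [him]; exact SMulMemClass.smul_mem _ (smulM _ _ (sub_mem hc (star_mem hc)))
  · rw [him, mul_smul_comm, mul_smul_comm, mul_sub, hpc, hpc']

/-- A corner without nonzero square-zero elements is commutative. -/
theorem IsBicommutantClosed.corner_commute {M : StarSubalgebra ℂ (K →L[ℂ] K)}
    (hM : IsBicommutantClosed M) {p : K →L[ℂ] K} (hp : IsStarProjection p) (hpM : p ∈ M)
    (hred : ∀ x ∈ M, p * x = x → x * p = x → x * x = 0 → x = 0) {c d : K →L[ℂ] K}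
    (hc : c ∈ M) (hpc : p * c = c) (hcp : c * p = c)
    (hd : d ∈ M) (hpd : p * d = d) (hdp : d * p = d) : Commute c d := by
  have hproj : ∀ q ∈ cornerProjections M p, Commute q d := by
    rintro q ⟨hq, hqM, hqp, hpq⟩
    have hqq := hq.isIdempotentElem.eq
    have h1 : q * d * (p - q) = 0 := by
      refine hred _ (mul_mem (mul_mem hqM hd) (sub_mem hpM hqM)) ?_ ?_ ?_
      · rw [← mul_assoc, ← mul_assoc, hpq]
      · rw [mul_assoc, sub_mul, hp.isIdempotentElem.eq, hqp]
      · have : (p - q) * q = 0 := by rw [sub_mul, hpq, hqq, sub_self]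
        calc q * d * (p - q) * (q * d * (p - q)) = q * d * ((p - q) * q) * d * (p - q) := by
              noncomm_ring
          _ = 0 := by rw [this]; simp
    have h2 : (p - q) * d * q = 0 := by
      refine hred _ (mul_mem (mul_mem (sub_mem hpM hqM) hd) hqM) ?_ ?_ ?_
      · rw [← mul_assoc, ← mul_assoc, mul_sub, hp.isIdempotentElem.eq, hpq]
      · rw [mul_assoc, hqp]
      · have : q * (p - q) = 0 := by rw [mul_sub, hqp, hqq, sub_self]
        calc (p - q) * d * q * ((p - q) * d * q) = (p - q) * d * (q * (p - q)) * d * q := by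
              noncomm_ring
          _ = 0 := by rw [this]; simp
    rw [mul_sub, mul_assoc, hdp, sub_eq_zero] at h1
    rw [sub_mul, sub_mul, hpd, sub_eq_zero] at h2
    exact h1.trans h2.symm
  have hcl := hM.mem_closure_span_cornerProjections hp hpM hc hpc hcp
  have hclosed : IsClosed {x : K →L[ℂ] K | x * d = d * x} :=
    isClosed_eq (by fun_prop) (by fun_prop)
  refine closure_minimal (fun x hx => ?_) hclosed hcl
  change Commute x d
  simp only [SetLike.mem_coe] at hx
  induction hx using Submodule.span_induction with
  | mem r hr => exact hproj r hr
  | zero => exact Commute.zero_left d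
  | add x y _ _ hx hy => exact hx.add_left hy
  | smul a x _ hx => exact hx.smul_left a

/-- The first column of a system of `n × n` matrix units in `M`: partial isometries
`v 0 = p, v 1, …, v (n - 1)` in `M` with common initial projection `p ≠ 0` and orthogonal
ranges. -/
structure IsColumnSystem (M : StarSubalgebra ℂ (K →L[ℂ] K)) (n : ℕ) (p : K →L[ℂ] K)
    (v : ℕ → K →L[ℂ] K) : Prop where
  pos : 0 < n
  proj : IsStarProjection p
  ne_zero : p ≠ 0
  mem : ∀ i, v i ∈ M
  head : v 0 = p
  tail : ∀ i, n ≤ i → v i = 0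
  inner : ∀ i j, i < n → j < n → star (v i) * v j = if i = j then p else 0

/-- The sum of the range projections of a column of partial isometries. -/
def columnSupport (N : ℕ) (v : ℕ → K →L[ℂ] K) : K →L[ℂ] K :=
  ∑ i ∈ Finset.range N, v i * star (v i)

theorem star_columnSupport (N : ℕ) (v : ℕ → K →L[ℂ] K) :
    star (columnSupport N v) = columnSupport N v := by
  simp [columnSupport]

theorem columnSupport_mem {M : StarSubalgebra ℂ (K →L[ℂ] K)} (N : ℕ) {v : ℕ → K →L[ℂ] K}
    (hv : ∀ i, v i ∈ M) : columnSupport N v ∈ M :=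
  sum_mem fun i _ => mul_mem (hv i) (star_mem (hv i))

namespace IsColumnSystem

variable {M : StarSubalgebra ℂ (K →L[ℂ] K)} {n : ℕ} {p : K →L[ℂ] K} {v : ℕ → K →L[ℂ] K}

theorem p_mem (h : IsColumnSystem M n p v) : p ∈ M := h.head ▸ h.mem 0

theorem mul_p (h : IsColumnSystem M n p v) (i : ℕ) : v i * p = v i := by
  rcases lt_or_ge i n with hi | hi
  · have h0 : star (v i - v i * p) * (v i - v i * p) = 0 := by
      have := h.inner i i hi hi
      rw [if_pos rfl] at this
      have hpp := h.proj.isIdempotentElem.eq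
      simp only [star_sub, star_mul, h.proj.isSelfAdjoint.star_eq, sub_mul, mul_sub]
      rw [this, mul_assoc p (star (v i)) (v i), ← mul_assoc (star (v i)) (v i) p, this,
        mul_assoc p (star (v i)), ← mul_assoc (star (v i)) (v i) p, this]
      simp [hpp]
    rw [CStarRing.star_mul_self_eq_zero_iff, sub_eq_zero] at h0
    exact h0.symm
  · rw [h.tail i hi, zero_mul]

theorem star_mul_eq_zero (h : IsColumnSystem M n p v) {i j : ℕ} (hij : i ≠ j) :
    star (v i) * v j = 0 := by
  rcases lt_or_ge i n with hi | hi
  · rcases lt_or_ge j n with hj | hj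
    · rw [h.inner i j hi hj, if_neg hij]
    · rw [h.tail j hj, mul_zero]
  · rw [h.tail i hi, star_zero, zero_mul]

theorem columnSupport_mul (h : IsColumnSystem M n p v) {N : ℕ} (hN : n ≤ N) (j : ℕ) :
    columnSupport N v * v j = v j := by
  rcases lt_or_ge j n with hj | hj
  · rw [columnSupport, Finset.sum_mul, Finset.sum_eq_single j]
    · rw [mul_assoc, h.inner j j hj hj, if_pos rfl, h.mul_p]
    · intro i _ hij
      rw [mul_assoc, h.star_mul_eq_zero hij, mul_zero]
    · intro hj'
      exact absurd (Finset.mem_range.2 (hj.trans_le hN)) hj'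
  · rw [h.tail j hj, mul_zero]

theorem norm_le_one (h : IsColumnSystem M n p v) (i : ℕ) : ‖v i‖ ≤ 1 := by
  rcases lt_or_ge i n with hi | hi
  · have h1 : ‖v i‖ * ‖v i‖ = ‖p‖ := by
      rw [← CStarRing.norm_star_mul_self, h.inner i i hi hi, if_pos rfl]
    have h2 : ‖p‖ ≤ 1 := h.proj.norm_le
    nlinarith [norm_nonneg (v i)]
  · rw [h.tail i hi]; simp

theorem extend (h : IsColumnSystem M n p v) {w : K →L[ℂ] K} (hw : w ∈ M)
    (hq : IsStarProjection (star w * w)) (hq0 : star w * w ≠ 0) (hpq : p * (star w * w) = star w * w)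
    (horth : ∀ i < n, star w * w * (star (v i) * w) = 0) :
    IsColumnSystem M (n + 1) (star w * w)
      fun i => if i < n then v i * (star w * w) else if i = n then w else 0 := by
  set q := star w * w with hqdef
  have hqs := hq.isSelfAdjoint.star_eq
  have hqq := hq.isIdempotentElem.eq
  have horth' : ∀ i < n, star w * v i * q = 0 := fun i hi => by
    simpa [hqs, mul_assoc] using congrArg star (horth i hi)
  refine ⟨Nat.succ_pos n, hq, hq0, ?_, ?_, ?_, ?_⟩
  · intro i
    split_ifs
    exacts [mul_mem (h.mem i) (mul_mem (star_mem hw) hw), hw, zero_mem _]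
  · rw [if_pos h.pos, h.head, hpq]
  · intro i hi
    rw [if_neg (by omega), if_neg (by omega)]
  · intro i j hi hj
    rcases Nat.lt_succ_iff_lt_or_eq.1 hi with hi | rfl
    · rcases Nat.lt_succ_iff_lt_or_eq.1 hj with hj | rfl
      · rw [if_pos hi, if_pos hj, star_mul, hqs, mul_assoc, ← mul_assoc (star (v i)),
          h.inner i j hi hj]
        split_ifs
        · rw [hpq, hqq]
        · simp
      · rw [if_pos hi, if_neg (lt_irrefl _), if_pos rfl, if_neg hi.ne, star_mul, hqs, mul_assoc,
          horth i hi]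
    · rw [if_neg (lt_irrefl _), if_pos rfl]
      rcases Nat.lt_succ_iff_lt_or_eq.1 hj with hj | rfl
      · rw [if_pos hj, if_neg hj.ne', ← mul_assoc, horth' j hj]
      · rw [if_neg (lt_irrefl _), if_pos rfl, if_pos rfl]

end IsColumnSystem

/-- A central summand of `M` which is a full matrix algebra over the commutative corner at `p`,
given by the first column `v` of its matrix units. -/
structure IsAbelianBlock (M : StarSubalgebra ℂ (K →L[ℂ] K)) (N : ℕ) (p : K →L[ℂ] K)
    (v : ℕ → K →L[ℂ] K) : Prop where
  proj : IsStarProjection p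
  ne_zero : p ≠ 0
  p_mem : p ∈ M
  mem : ∀ i, v i ∈ M
  mul_p : ∀ i, v i * p = v i
  star_mul_eq_zero : ∀ i j, i ≠ j → star (v i) * v j = 0
  norm_le_one : ∀ i, ‖v i‖ ≤ 1
  support_mul : ∀ i, columnSupport N v * v i = v i
  support_mul_p : columnSupport N v * p = p
  support_comm : ∀ x ∈ M, Commute (columnSupport N v) x
  corner_comm : ∀ x ∈ M, ∀ y ∈ M, Commute (p * x * p) (p * y * p)

theorem IsColumnSystem.exists_extend_of_not_isAbelianBlock {M : StarSubalgebra ℂ (K →L[ℂ] K)}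
    (hM : IsBicommutantClosed M) {n N : ℕ} (hN : n ≤ N) {p : K →L[ℂ] K} {v : ℕ → K →L[ℂ] K}
    (h : IsColumnSystem M n p v) (hb : ¬ IsAbelianBlock M N p v) :
    ∃ q u, IsColumnSystem M (n + 1) q u ∧ p * q = q := by
  have hpp := h.proj.isIdempotentElem.eq
  by_contra! hno
  have noExt : ∀ w ∈ M, IsStarProjection (star w * w) → star w * w ≠ 0 →
      p * (star w * w) = star w * w → ¬ ∀ i < n, star w * w * (star (v i) * w) = 0 :=
    fun w hw hq hq0 hpq horth => hno _ _ (h.extend hw hq hq0 hpq horth) hpq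
  have below : ∀ q : K →L[ℂ] K, IsStarProjection q → q * (1 - p) = 0 → p * q = q := by
    intro q hq hqp
    rw [mul_sub, mul_one, sub_eq_zero] at hqp
    simpa [hq.isSelfAdjoint.star_eq, h.proj.isSelfAdjoint.star_eq] using (congrArg star hqp).symm
  have hcomm : ∀ x ∈ M, ∀ y ∈ M, Commute (p * x * p) (p * y * p) := by
    intro x hx y hy
    have left : ∀ z, p * (p * z * p) = p * z * p := fun z => by rw [← mul_assoc, ← mul_assoc, hpp]
    have right : ∀ z, p * z * p * p = p * z * p := fun z => by rw [mul_assoc, hpp]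
    refine hM.corner_commute h.proj h.p_mem ?_ (mul_mem (mul_mem h.p_mem hx) h.p_mem) (left x)
      (right x) (mul_mem (mul_mem h.p_mem hy) h.p_mem) (left y) (right y)
    intro x hx hpx hxp hxx
    by_contra hx0
    obtain ⟨w, hw, hq, hq0, hker, hran⟩ := hM.exists_partialIsometry hx hx0
    have hpw : p * w = w := by
      have := hran (1 - p) (by rw [sub_mul, hpx, one_mul, sub_self])
      rw [sub_mul, one_mul, sub_eq_zero] at this
      exact this.symm
    have hxw : star w * w * w = 0 := by
      rw [mul_assoc]
      have := hran (star w * w) ?_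
      · rwa [mul_assoc] at this
      · exact hker x hxx
    refine noExt w hw hq hq0 (below _ hq (hker _ (by rw [mul_sub, hxp, mul_one, sub_self]))) ?_
    intro i hi
    have hvw : star (v i) * w = (if i = 0 then p else 0) * w := by
      rw [← h.inner i 0 hi h.pos, mul_assoc, h.head, hpw]
    rw [hvw]
    split_ifs
    · rw [hpw, hxw]
    · simp
  refine hb ⟨h.proj, h.ne_zero, h.p_mem, h.mem, h.mul_p, fun i j => h.star_mul_eq_zero,
    h.norm_le_one, h.columnSupport_mul hN, ?_, ?_, hcomm⟩
  · rw [← h.head]; exact h.columnSupport_mul hN 0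
  set e := columnSupport N v with he
  have hestar : star e = e := star_columnSupport N v
  have heM : e ∈ M := columnSupport_mem N h.mem
  have hev : ∀ i, e * v i = v i := h.columnSupport_mul hN
  have hoff : ∀ x ∈ M, (1 - e) * x * p = 0 := by
    intro x hx
    by_contra hx0
    obtain ⟨w, hw, hq, hq0, hker, hran⟩ := hM.exists_partialIsometry
      (mul_mem (mul_mem (sub_mem (one_mem _) heM) hx) h.p_mem) hx0
    have hee : e * e = e := by
      nth_rw 2 [he]
      rw [columnSupport, Finset.mul_sum]
      simp only [← mul_assoc, hev]
      rfl
    have hew : e * w = 0 := hran e (by rw [← mul_assoc, ← mul_assoc, mul_sub, hee]; simp)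
    refine noExt w hw hq hq0 (below _ hq (hker _ ?_)) ?_
    · rw [mul_assoc, mul_sub, hpp, mul_one, sub_self, mul_zero]
    · intro i _
      have : star (v i) * w = star (v i) * (e * w) := by
        rw [← mul_assoc]
        congr 1
        simpa [hestar] using (congrArg star (hev i)).symm
      rw [this, hew]; simp
  have hoff' : ∀ x ∈ M, (1 - e) * x * e = 0 := by
    intro x hx
    rw [show (1 - e) * x * e = (1 - e) * x * ∑ i ∈ Finset.range N, v i * star (v i) from rfl,
      Finset.mul_sum]
    refine Finset.sum_eq_zero fun i _ => ?_
    have := hoff (x * v i) (mul_mem hx (h.mem i))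
    rw [← mul_assoc (1 - e), mul_assoc _ (v i) p, h.mul_p] at this
    rw [← mul_assoc, this, zero_mul]
  intro x hx
  have h1 := hoff' x hx
  have h2 := congrArg star (hoff' (star x) (star_mem hx))
  simp only [star_mul, star_sub, star_one, hestar, star_star, star_zero] at h2
  rw [sub_mul, sub_mul, one_mul, sub_eq_zero] at h1
  rw [mul_sub, mul_sub, mul_one, sub_eq_zero] at h2
  exact h2.trans ((mul_assoc e x e).symm.trans h1.symm)

theorem exists_isAbelianBlock {M : StarSubalgebra ℂ (K →L[ℂ] K)}
    (hM : IsBicommutantClosed M) {N : ℕ}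
    (hbound : ∀ n p v, IsColumnSystem M n p v → n ≤ N) {r : K →L[ℂ] K}
    (hr : IsStarProjection r) (hrM : r ∈ M) (hr0 : r ≠ 0) :
    ∃ p v, IsAbelianBlock M N p v ∧ r * p = p := by
  by_contra! hno
  have grow : ∀ n, ∃ p v, IsColumnSystem M (n + 1) p v ∧ r * p = p := by
    intro n
    induction n with
    | zero =>
      refine ⟨r, fun i => if i = 0 then r else 0,
        ⟨Nat.one_pos, hr, hr0, ?_, if_pos rfl, ?_, ?_⟩, hr.isIdempotentElem.eq⟩
      · intro i
        split_ifs
        exacts [hrM, zero_mem _]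
      · intro i hi
        rw [if_neg (by omega)]
      · intro i j hi hj
        obtain rfl : i = 0 := by omega
        obtain rfl : j = 0 := by omega
        simp [hr.isSelfAdjoint.star_eq, hr.isIdempotentElem.eq]
    | succ n ih =>
      obtain ⟨p, v, h, hrp⟩ := ih
      obtain ⟨q, u, h', hpq⟩ := h.exists_extend_of_not_isAbelianBlock hM (hbound _ _ _ h)
        fun hb => hno p v hb hrp
      exact ⟨q, u, h', by rw [← hpq, ← mul_assoc, hrp]⟩
  obtain ⟨p, v, h, -⟩ := grow N
  exact absurd (hbound _ _ _ h) (by omega)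

theorem norm_sq_sum_of_orthogonal {ι E : Type*} [NormedAddCommGroup E] [InnerProductSpace ℂ E]
    {f : ι → E}
    (hf : ∀ s t, s ≠ t → inner ℂ (f s) (f t) = 0) (F : Finset ι) :
    ‖∑ s ∈ F, f s‖ ^ 2 = ∑ s ∈ F, ‖f s‖ ^ 2 := by
  classical
  induction F using Finset.induction_on with
  | empty => simp
  | insert a F ha ih =>
    rw [Finset.sum_insert ha, Finset.sum_insert ha, ← ih, pow_two, pow_two, pow_two,
      norm_add_sq_eq_norm_sq_add_norm_sq_of_inner_eq_zero (𝕜 := ℂ)]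
    rw [inner_sum]
    exact Finset.sum_eq_zero fun t ht => hf a t fun h => ha (h ▸ ht)

/-- Bessel's inequality for a family of orthogonal projections. -/
theorem sum_norm_sq_apply_le {ι : Type*} {z : ι → K →L[ℂ] K} (hz : ∀ s, IsStarProjection (z s))
    (horth : ∀ s t, s ≠ t → z s * z t = 0) (F : Finset ι) (ξ : K) :
    ∑ s ∈ F, ‖z s ξ‖ ^ 2 ≤ ‖ξ‖ ^ 2 := by
  have hinner : ∀ s t η ζ, inner ℂ (z s η) (z t ζ) = inner ℂ η ((z s * z t) ζ) := by
    intro s t η ζ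
    rw [← ContinuousLinearMap.adjoint_inner_right, ← ContinuousLinearMap.star_eq_adjoint,
      (hz s).isSelfAdjoint.star_eq]
    rfl
  have h1 := norm_sq_sum_of_orthogonal (f := fun s => z s ξ)
    (fun s t hst => by rw [hinner, horth s t hst]; simp) F
  have h2 : (∑ s ∈ F, ‖z s ξ‖ ^ 2 : ℝ) = RCLike.re (inner ℂ ξ (∑ s ∈ F, z s ξ)) := by
    rw [inner_sum, map_sum]
    refine Finset.sum_congr rfl fun s _ => ?_
    rw [← inner_self_eq_norm_sq (𝕜 := ℂ), hinner, (hz s).isIdempotentElem.eq]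
  have h3 := re_inner_le_norm (𝕜 := ℂ) ξ (∑ s ∈ F, z s ξ)
  rw [← h2, ← h1] at h3
  rw [← h1]
  have h4 := norm_nonneg (∑ s ∈ F, z s ξ)
  have h5 := norm_nonneg ξ
  have h6 : ‖∑ s ∈ F, z s ξ‖ ≤ ‖ξ‖ := by
    by_contra! h
    nlinarith
  nlinarith

/-- A bounded family of operators supported on pairwise orthogonal projections has an orthogonal
sum. -/
theorem exists_orthogonal_sum {ι : Type*} {z x : ι → K →L[ℂ] K}
    (hz : ∀ s, IsStarProjection (z s)) (horth : ∀ s t, s ≠ t → z s * z t = 0)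
    (hzx : ∀ s, z s * x s = x s) (hxz : ∀ s, x s * z s = x s) (hn : ∀ s, ‖x s‖ ≤ 1) :
    ∃ X : K →L[ℂ] K, ∀ s, z s * X = x s ∧ X * z s = x s := by
  classical
  have hzx0 : ∀ s t, s ≠ t → z s * x t = 0 := fun s t hst => by
    rw [← hzx t, ← mul_assoc, horth s t hst, zero_mul]
  have hxz0 : ∀ s t, s ≠ t → x s * z t = 0 := fun s t hst => by
    rw [← hxz s, mul_assoc, horth s t hst, mul_zero]
  have hxo : ∀ ξ s t, s ≠ t → inner ℂ (x s ξ) (x t ξ) = 0 := by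
    intro ξ s t hst
    have : x s ξ = z s (x s ξ) := (DFunLike.congr_fun (hzx s) ξ).symm
    rw [this, ← ContinuousLinearMap.adjoint_inner_right, ← ContinuousLinearMap.star_eq_adjoint,
      (hz s).isSelfAdjoint.star_eq]
    have h0 : z s (x t ξ) = 0 := DFunLike.congr_fun (hzx0 s t hst) ξ
    rw [h0, inner_zero_right]
  have hle : ∀ ξ s, ‖x s ξ‖ ≤ ‖z s ξ‖ := by
    intro ξ s
    calc ‖x s ξ‖ = ‖x s (z s ξ)‖ := by rw [← DFunLike.congr_fun (hxz s) ξ]; rfl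
      _ ≤ 1 * ‖z s ξ‖ := (x s).le_of_opNorm_le (hn s) _
      _ = ‖z s ξ‖ := one_mul _
  have hsq : ∀ ξ (F : Finset ι), ‖∑ s ∈ F, x s ξ‖ ^ 2 = ∑ s ∈ F, ‖x s ξ‖ ^ 2 :=
    fun ξ F => norm_sq_sum_of_orthogonal (hxo ξ) F
  have hbd : ∀ ξ (F : Finset ι), ∑ s ∈ F, ‖x s ξ‖ ^ 2 ≤ ‖ξ‖ ^ 2 := fun ξ F =>
    (Finset.sum_le_sum fun s _ => pow_le_pow_left₀ (norm_nonneg _) (hle ξ s) 2).trans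
      (sum_norm_sq_apply_le hz horth F ξ)
  have hsum : ∀ ξ, Summable fun s => x s ξ := by
    intro ξ
    have hs : Summable fun s => ‖x s ξ‖ ^ 2 :=
      summable_of_sum_le (fun s => sq_nonneg _) (hbd ξ)
    rw [summable_iff_vanishing_norm] at hs ⊢
    intro ε hε
    obtain ⟨s, hs⟩ := hs (ε ^ 2) (by positivity)
    refine ⟨s, fun t ht => ?_⟩
    have := (le_abs_self _).trans_lt (hs t ht)
    rw [← hsq] at this
    exact lt_of_pow_lt_pow_left₀ 2 hε.le this
  let X : K →L[ℂ] K := LinearMap.mkContinuous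
    { toFun := fun ξ => ∑' s, x s ξ
      map_add' := fun ξ η => by
        simp only [map_add]
        exact (hsum ξ).tsum_add (hsum η)
      map_smul' := fun c ξ => by
        simp only [map_smul, RingHom.id_apply]
        exact (hsum ξ).tsum_const_smul c } 1 fun ξ => by
    rw [one_mul]
    refine le_of_tendsto (hsum ξ).hasSum.norm (Filter.Eventually.of_forall fun F => ?_)
    refine le_of_sq_le_sq ?_ (norm_nonneg _)
    rw [hsq]
    exact hbd ξ F
  have hX : ∀ ξ, X ξ = ∑' s, x s ξ := fun _ => rfl
  refine ⟨X, fun s => ⟨?_, ?_⟩⟩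
  · ext ξ
    change z s (X ξ) = _
    rw [hX, (z s).map_tsum (hsum ξ), tsum_eq_single s]
    · exact DFunLike.congr_fun (hzx s) ξ
    · intro t ht
      exact DFunLike.congr_fun (hzx0 s t ht.symm) ξ
  · ext ξ
    change X (z s ξ) = _
    rw [hX, tsum_eq_single s]
    · exact DFunLike.congr_fun (hxz s) ξ
    · intro t ht
      exact DFunLike.congr_fun (hxz0 t s ht) ξ

namespace IsAbelianBlock

variable {M : StarSubalgebra ℂ (K →L[ℂ] K)} {N : ℕ} {p : K →L[ℂ] K} {v : ℕ → K →L[ℂ] K}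

theorem isStarProjection_support (h : IsAbelianBlock M N p v) :
    IsStarProjection (columnSupport N v) := by
  refine ⟨?_, star_columnSupport N v⟩
  change _ * _ = _
  nth_rw 2 [columnSupport]
  rw [Finset.mul_sum]
  simp only [← mul_assoc, h.support_mul]
  rfl

theorem support_mem (h : IsAbelianBlock M N p v) : columnSupport N v ∈ M :=
  columnSupport_mem N h.mem

theorem support_ne_zero (h : IsAbelianBlock M N p v) : columnSupport N v ≠ 0 := by
  intro h0
  have := h.support_mul_p
  rw [h0, zero_mul] at this
  exact h.ne_zero this.symm

end IsAbelianBlock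

/-- A maximal orthogonal family of abelian blocks separates. -/
theorem exists_maximal_blocks {M : StarSubalgebra ℂ (K →L[ℂ] K)}
    (hM : IsBicommutantClosed M) {N : ℕ}
    (hbound : ∀ n p v, IsColumnSystem M n p v → n ≤ N) :
    ∃ S : Set ((K →L[ℂ] K) × (ℕ → K →L[ℂ] K)), (∀ s ∈ S, IsAbelianBlock M N s.1 s.2) ∧
      (∀ s ∈ S, ∀ t ∈ S, s ≠ t → columnSupport N s.2 * columnSupport N t.2 = 0) ∧
      ∀ y : K →L[ℂ] K, (∀ s ∈ S, columnSupport N s.2 * y = 0) → y = 0 := by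
  let 𝒮 : Set (Set ((K →L[ℂ] K) × (ℕ → K →L[ℂ] K))) :=
    {S | (∀ s ∈ S, IsAbelianBlock M N s.1 s.2) ∧
      ∀ s ∈ S, ∀ t ∈ S, s ≠ t → columnSupport N s.2 * columnSupport N t.2 = 0}
  obtain ⟨S, hS⟩ := zorn_subset 𝒮 (by
    intro c hc hchain
    refine ⟨⋃₀ c, ⟨?_, ?_⟩, fun s hs => Set.subset_sUnion_of_mem hs⟩
    · rintro s ⟨T, hT, hs⟩
      exact (hc hT).1 s hs
    · rintro s ⟨T, hT, hs⟩ t ⟨U, hU, ht⟩ hst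
      rcases hchain.total hT hU with h | h
      · exact (hc hU).2 s (h hs) t ht hst
      · exact (hc hT).2 s hs t (h ht) hst)
  refine ⟨S, hS.prop.1, hS.prop.2, ?_⟩
  obtain ⟨r, hr, hr0, hmax, hcomm⟩ := exists_kerProjection ((fun s => columnSupport N s.2) '' S)
  simp only [Set.forall_mem_image] at hr0 hmax hcomm
  have hrs := hr.isSelfAdjoint.star_eq
  have hrM : r ∈ M := hM r fun t ht => by
    refine hcomm t (fun s hs => ht _ (hS.prop.1 s hs).support_mem) fun s hs => ?_
    have := ht _ (star_mem (hS.prop.1 s hs).support_mem)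
    simpa [star_columnSupport] using this.star_star
  have hrc : ∀ x ∈ M, Commute x r := fun x hx =>
    hcomm x (fun s hs => ((hS.prop.1 s hs).support_comm x hx).symm)
      fun s hs => ((hS.prop.1 s hs).support_comm _ (star_mem hx)).symm
  intro y hy
  suffices hr' : r = 0 by
    have := hmax y fun s hs => hy s hs
    rw [hr', zero_mul] at this
    exact this.symm
  by_contra hne
  obtain ⟨p, v, hb, hrp⟩ := exists_isAbelianBlock hM hbound hr hrM hne
  have hrv : ∀ i, r * v i = v i := fun i => by
    have := (hrc _ (hb.mem i)).eq
    rw [← hb.mul_p i, ← mul_assoc, ← this, mul_assoc, hrp]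
  have hrz : r * columnSupport N v = columnSupport N v := by
    rw [columnSupport, Finset.mul_sum]
    simp only [← mul_assoc, hrv]
  have hz1 : ∀ s ∈ S, columnSupport N s.2 * columnSupport N v = 0 := fun s hs => by
    rw [← hrz, ← mul_assoc, hr0 hs, zero_mul]
  have hz2 : ∀ s ∈ S, columnSupport N v * columnSupport N s.2 = 0 := fun s hs => by
    simpa [star_columnSupport] using congrArg star (hz1 s hs)
  have hmem : insert (p, v) S ∈ 𝒮 := by
    refine ⟨?_, ?_⟩
    · rintro s (rfl | hs)
      exacts [hb, hS.prop.1 s hs]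
    · rintro s (rfl | hs) t (rfl | ht) hst
      exacts [absurd rfl hst, hz2 t ht, hz1 s hs, hS.prop.2 s hs t ht hst]
  have hin : (p, v) ∈ S := hS.le_of_ge hmem (Set.subset_insert _ _) (Set.mem_insert _ _)
  have := hz1 _ hin
  rw [hb.isStarProjection_support.isIdempotentElem.eq] at this
  exact hb.support_ne_zero this

/-- Partial isometries `V 0, …, V (N - 1)` in `M` whose initial projections lie below `P`, whose
ranges are orthogonal and fill the space, and such that the corner of `M` at `P` is
commutative. -/
structure IsAbelianFrame (M : StarSubalgebra ℂ (K →L[ℂ] K)) (N : ℕ) (P : K →L[ℂ] K)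
    (V : ℕ → K →L[ℂ] K) : Prop where
  proj : IsStarProjection P
  p_mem : P ∈ M
  mem : ∀ i, V i ∈ M
  mul_p : ∀ i, V i * P = V i
  star_mul_eq_zero : ∀ i j, i ≠ j → star (V i) * V j = 0
  support_eq_one : columnSupport N V = 1
  corner_comm : ∀ x ∈ M, ∀ y ∈ M, Commute (P * x * P) (P * y * P)

theorem exists_isAbelianFrame {M : StarSubalgebra ℂ (K →L[ℂ] K)}
    (hM : IsBicommutantClosed M) {N : ℕ}
    (hbound : ∀ n p v, IsColumnSystem M n p v → n ≤ N) :
    ∃ P V, IsAbelianFrame M N P V := by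
  obtain ⟨S, hS, horth, hsep⟩ := exists_maximal_blocks hM hbound
  let z : S → K →L[ℂ] K := fun s => columnSupport N s.1.2
  have hb : ∀ s : S, IsAbelianBlock M N s.1.1 s.1.2 := fun s => hS s.1 s.2
  have hz : ∀ s, IsStarProjection (z s) := fun s => (hb s).isStarProjection_support
  have hzo : ∀ s t, s ≠ t → z s * z t = 0 := fun s t hst =>
    horth s.1 s.2 t.1 t.2 fun h => hst (Subtype.ext h)
  have hzM : ∀ s, ∀ x ∈ M, Commute (z s) x := fun s => (hb s).support_comm
  have ext : ∀ a b : K →L[ℂ] K, (∀ s, z s * a = z s * b) → a = b := fun a b hab =>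
    sub_eq_zero.1 <| hsep _ fun s hs => by
      rw [mul_sub, sub_eq_zero]
      exact hab ⟨s, hs⟩
  have glue : ∀ x : S → K →L[ℂ] K, (∀ s, x s ∈ M) → (∀ s, z s * x s = x s) →
      (∀ s, ‖x s‖ ≤ 1) → ∃ X ∈ M, ∀ s, z s * X = x s := by
    intro x hx hzx hn
    obtain ⟨X, hX⟩ := exists_orthogonal_sum hz hzo hzx
      (fun s => by rw [← (hzM s _ (hx s)).eq, hzx]) hn
    refine ⟨X, hM X fun t ht => ext _ _ fun s => ?_, fun s => (hX s).1⟩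
    rw [← mul_assoc, ← mul_assoc, ← (ht _ (hb s).support_mem).eq, mul_assoc, (hX s).1,
      (ht _ (hx s)).eq]
  choose V hVM hV using fun i => glue (fun s => s.1.2 i) (fun s => (hb s).mem i)
    (fun s => (hb s).support_mul i) (fun s => (hb s).norm_le_one i)
  obtain ⟨P, hPM, hP⟩ := glue (fun s => s.1.1) (fun s => (hb s).p_mem)
    (fun s => (hb s).support_mul_p) (fun s => (hb s).proj.norm_le)
  have zmul : ∀ s, ∀ a ∈ M, ∀ b, z s * (a * b) = z s * a * (z s * b) := by
    intro s a ha b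
    rw [mul_assoc, ← mul_assoc a, ← (hzM s a ha).eq, mul_assoc (z s) a b, ← mul_assoc (z s) (z s),
      (hz s).isIdempotentElem.eq]
  have zstar : ∀ s, ∀ a ∈ M, z s * star a = star (z s * a) := by
    intro s a ha
    rw [star_mul, (hz s).isSelfAdjoint.star_eq, (hzM s _ (star_mem ha)).eq]
  refine ⟨P, V, ⟨ext _ _ fun s => ?_, ext _ _ fun s => ?_⟩, hPM, hVM, fun i => ext _ _ fun s => ?_,
    fun i j hij => ext _ _ fun s => ?_, ext _ _ fun s => ?_, fun x hx y hy => ext _ _ fun s => ?_⟩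
  · rw [zmul s P hPM, hP, (hb s).proj.isIdempotentElem.eq]
  · rw [zstar s P hPM, hP, (hb s).proj.isSelfAdjoint.star_eq]
  · rw [zmul s _ (hVM i), hV, hP, (hb s).mul_p]
  · rw [zmul s _ (star_mem (hVM i)), zstar s _ (hVM i), hV, hV, (hb s).star_mul_eq_zero i j hij,
      mul_zero]
  · rw [columnSupport, Finset.mul_sum, mul_one]
    refine Finset.sum_congr rfl fun i _ => ?_
    rw [zmul s _ (hVM i), zstar s _ (hVM i), hV]
  · have corner : ∀ a ∈ M, z s * (P * a * P) = s.1.1 * a * s.1.1 := fun a ha => by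
      have hc := ((hb s).support_comm _ ha).eq
      change z s * a = _ at hc
      rw [mul_assoc, zmul s P hPM, hP, zmul s a ha, hP, hc, ← mul_assoc, ← mul_assoc]
      rw [mul_assoc _ (z s), (hb s).support_mul_p]
    have cm : ∀ a ∈ M, P * a * P ∈ M := fun a ha => mul_mem (mul_mem hPM ha) hPM
    rw [zmul s _ (cm x hx), zmul s _ (cm y hy), corner x hx, corner y hy]
    exact (hb s).corner_comm x hx y hy

/-- A finite set of commuting projections below `p` generates a finite multiplicative set. -/
theorem exists_finite_mul_closed {M : StarSubalgebra ℂ (K →L[ℂ] K)} {p : K →L[ℂ] K}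
    (hcomm : ∀ x ∈ M, ∀ y ∈ M, Commute (p * x * p) (p * y * p)) {Q : Set (K →L[ℂ] K)}
    (hQ : Q.Finite) (hQp : Q ⊆ cornerProjections M p) :
    ∃ T : Set (K →L[ℂ] K), T.Finite ∧ Q ⊆ T ∧ T ⊆ cornerProjections M p ∧
      ∀ a ∈ T, ∀ b ∈ T, a * b ∈ T := by
  have hc : ∀ a ∈ cornerProjections M p, ∀ b ∈ cornerProjections M p, Commute a b := by
    rintro a ⟨-, haM, hap, hpa⟩ b ⟨-, hbM, hbp, hpb⟩
    have := hcomm a haM b hbM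
    rwa [hpa, hap, hpb, hbp] at this
  induction Q, hQ using Set.Finite.induction_on with
  | empty => exact ⟨∅, Set.finite_empty, le_rfl, Set.empty_subset _, by simp⟩
  | @insert q Q _ _ ih =>
    obtain ⟨T, hT, hQT, hTp, hmul⟩ := ih ((Set.subset_insert _ _).trans hQp)
    have hq : q ∈ cornerProjections M p := hQp (Set.mem_insert _ _)
    have hqq := hq.1.isIdempotentElem.eq
    have hqT : ∀ a ∈ T, Commute q a := fun a ha => hc q hq a (hTp ha)
    refine ⟨insert q (T ∪ (q * ·) '' T), (hT.union (hT.image _)).insert _,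
      Set.insert_subset_insert (hQT.trans Set.subset_union_left), ?_, ?_⟩
    · rintro _ (rfl | ha | ⟨a, ha, rfl⟩)
      · exact hq
      · exact hTp ha
      · obtain ⟨h1, h2, h3, h4⟩ := hTp ha
        exact ⟨hq.1.mul h1 (hqT a ha), mul_mem hq.2.1 h2, by rw [mul_assoc, h3],
          by rw [← mul_assoc, hq.2.2.2]⟩
    · rintro _ (rfl | ha | ⟨a, ha, rfl⟩) _ (rfl | hb | ⟨b, hb, rfl⟩)
      · simp [hqq]
      · exact Or.inr (Or.inr ⟨_, hb, rfl⟩)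
      · exact Or.inr (Or.inr ⟨_, hb, by simp only [← mul_assoc, hqq]⟩)
      · exact Or.inr (Or.inr ⟨_, ha, (hqT _ ha).eq⟩)
      · exact Or.inr (Or.inl (hmul _ ha _ hb))
      · exact Or.inr (Or.inr ⟨_, hmul _ ha _ hb, by
          simp only [← mul_assoc]; rw [(hqT _ ha).eq]⟩)
      · exact Or.inr (Or.inr ⟨_, ha, by
          simp only; rw [mul_assoc, ← (hqT _ ha).eq, ← mul_assoc, hqq]⟩)
      · exact Or.inr (Or.inr ⟨_, hmul _ ha _ hb, by simp only [← mul_assoc]⟩)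
      · exact Or.inr (Or.inr ⟨_, hmul _ ha _ hb, by
          simp only
          rw [mul_assoc, ← mul_assoc a, ← (hqT _ ha).eq, mul_assoc q a, ← mul_assoc q q, hqq]⟩)

/-- The elements `V i * q * (V j)⋆` with `i, j < N` and `q ∈ Q`. -/
def frameGenerators (N : ℕ) (V : ℕ → K →L[ℂ] K) (Q : Set (K →L[ℂ] K)) : Set (K →L[ℂ] K) :=
  {x | ∃ i < N, ∃ j < N, ∃ q ∈ Q, x = V i * q * star (V j)}

theorem frameGenerators_mono {N : ℕ} {V : ℕ → K →L[ℂ] K} {Q R : Set (K →L[ℂ] K)} (h : Q ⊆ R) :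
    frameGenerators N V Q ⊆ frameGenerators N V R := by
  rintro _ ⟨i, hi, j, hj, q, hq, rfl⟩
  exact ⟨i, hi, j, hj, q, h hq, rfl⟩

theorem finite_frameGenerators {N : ℕ} {V : ℕ → K →L[ℂ] K} {Q : Set (K →L[ℂ] K)}
    (hQ : Q.Finite) : (frameGenerators N V Q).Finite := by
  refine ((((Set.finite_lt_nat N).prod (Set.finite_lt_nat N)).prod hQ).image
    fun s => V s.1.1 * s.2 * star (V s.1.2)).subset ?_
  rintro _ ⟨i, hi, j, hj, q, hq, rfl⟩
  exact ⟨((i, j), q), ⟨⟨hi, hj⟩, hq⟩, rfl⟩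

theorem exists_finite_mem_span_frameGenerators {N : ℕ} {V : ℕ → K →L[ℂ] K}
    {C : Set (K →L[ℂ] K)} {x : K →L[ℂ] K} (hx : x ∈ Submodule.span ℂ (frameGenerators N V C)) :
    ∃ Q ⊆ C, Q.Finite ∧ x ∈ Submodule.span ℂ (frameGenerators N V Q) := by
  induction hx using Submodule.span_induction with
  | mem x hx =>
    obtain ⟨i, hi, j, hj, q, hq, rfl⟩ := hx
    exact ⟨{q}, by simpa using hq, Set.finite_singleton q,
      Submodule.subset_span ⟨i, hi, j, hj, q, rfl, rfl⟩⟩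
  | zero => exact ⟨∅, Set.empty_subset _, Set.finite_empty, zero_mem _⟩
  | add x y _ _ ihx ihy =>
    obtain ⟨Q, hQ, hQf, hxQ⟩ := ihx
    obtain ⟨R, hR, hRf, hyR⟩ := ihy
    exact ⟨Q ∪ R, Set.union_subset hQ hR, hQf.union hRf,
      add_mem (Submodule.span_mono (frameGenerators_mono Set.subset_union_left) hxQ)
        (Submodule.span_mono (frameGenerators_mono Set.subset_union_right) hyR)⟩
  | smul c x _ ih =>
    obtain ⟨Q, hQ, hQf, hxQ⟩ := ih
    exact ⟨Q, hQ, hQf, Submodule.smul_mem _ _ hxQ⟩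

namespace IsAbelianFrame

variable {M : StarSubalgebra ℂ (K →L[ℂ] K)} {N : ℕ} {P : K →L[ℂ] K} {V : ℕ → K →L[ℂ] K}

theorem initial_mem (h : IsAbelianFrame M N P V) (j : ℕ) :
    star (V j) * V j ∈ cornerProjections M P := by
  have hV : V j * (star (V j) * V j) = V j := by
    have h1 : columnSupport N V * V j = V j := by rw [h.support_eq_one, one_mul]
    rw [columnSupport, Finset.sum_mul] at h1
    by_cases hj : j < N
    · rw [Finset.sum_eq_single j, mul_assoc] at h1
      · exact h1
      · intro i _ hij
        rw [mul_assoc, h.star_mul_eq_zero i j hij, mul_zero]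
      · exact fun hj' => absurd (Finset.mem_range.2 hj) hj'
    · have : V j = 0 := by
        rw [← h1]
        refine Finset.sum_eq_zero fun i hi => ?_
        rw [mul_assoc, h.star_mul_eq_zero i j (by rintro rfl; exact hj (Finset.mem_range.1 hi)),
          mul_zero]
      simp [this]
  have hP : star (V j) * V j * P = star (V j) * V j := by rw [mul_assoc, h.mul_p]
  refine ⟨⟨?_, ?_⟩, mul_mem (star_mem (h.mem j)) (h.mem j), hP, ?_⟩
  · change _ * _ = _
    rw [mul_assoc, hV]
  · exact IsSelfAdjoint.star_mul_self _
  · simpa [h.proj.isSelfAdjoint.star_eq, mul_assoc] using congrArg star hP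

theorem mem_closure_span (hM : IsBicommutantClosed M) (h : IsAbelianFrame M N P V)
    {b : K →L[ℂ] K} (hb : b ∈ M) :
    b ∈ (Submodule.span ℂ
      (frameGenerators N V (cornerProjections M P))).topologicalClosure := by
  have hdec : b = ∑ i ∈ Finset.range N, ∑ j ∈ Finset.range N,
      V i * (star (V i) * b * V j) * star (V j) := by
    calc b = columnSupport N V * b * columnSupport N V := by
          rw [h.support_eq_one, one_mul, mul_one]
      _ = _ := by
        simp only [columnSupport, Finset.sum_mul, Finset.mul_sum, mul_assoc]
        rw [Finset.sum_comm]
  rw [hdec]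
  refine sum_mem fun i hi => sum_mem fun j hj => ?_
  have hPV : ∀ i, P * star (V i) = star (V i) := fun i => by
    simpa [h.proj.isSelfAdjoint.star_eq] using congrArg star (h.mul_p i)
  have hc := hM.mem_closure_span_cornerProjections (c := star (V i) * b * V j) h.proj h.p_mem
    (mul_mem (mul_mem (star_mem (h.mem i)) hb) (h.mem j))
    (by rw [← mul_assoc, ← mul_assoc, hPV]) (by rw [mul_assoc, h.mul_p])
  have hcont : Continuous fun c : K →L[ℂ] K => V i * c * star (V j) := by fun_prop
  refine map_mem_closure (f := fun c => V i * c * star (V j)) hcont hc fun x hx => ?_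
  simp only [SetLike.mem_coe] at hx ⊢
  induction hx using Submodule.span_induction with
  | mem q hq =>
    exact Submodule.subset_span ⟨i, Finset.mem_range.1 hi, j, Finset.mem_range.1 hj, q, hq, rfl⟩
  | zero => simp
  | add x y _ _ hx hy =>
    rw [mul_add, add_mul]
    exact add_mem hx hy
  | smul a x _ hx =>
    rw [mul_smul_comm, smul_mul_assoc]
    exact Submodule.smul_mem _ _ hx

theorem exists_starSubalgebra (h : IsAbelianFrame M N P V) {Q : Set (K →L[ℂ] K)}
    (hQ : Q.Finite) (hQP : Q ⊆ cornerProjections M P) :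
    ∃ D : StarSubalgebra ℂ (K →L[ℂ] K), D ≤ M ∧ FiniteDimensional ℂ D ∧
      ∀ x ∈ Submodule.span ℂ (frameGenerators N V Q), x ∈ D := by
  let Q' := Q ∪ insert P ((fun j => star (V j) * V j) '' {j | j < N})
  have hPP := h.proj.isIdempotentElem.eq
  have hQ' : Q'.Finite := hQ.union (((Set.finite_lt_nat N).image _).insert _)
  have hQ'P : Q' ⊆ cornerProjections M P := by
    rintro _ (hq | rfl | ⟨j, _, rfl⟩)
    exacts [hQP hq, ⟨h.proj, h.p_mem, hPP, hPP⟩, h.initial_mem j]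
  obtain ⟨T, hT, hQT, hTP, hmul⟩ := exists_finite_mul_closed h.corner_comm hQ' hQ'P
  have hgmul : ∀ x ∈ frameGenerators N V T, ∀ y ∈ frameGenerators N V T,
      x * y ∈ Submodule.span ℂ (frameGenerators N V T) := by
    rintro _ ⟨i, hi, j, hj, q, hq, rfl⟩ _ ⟨k, hk, l, hl, r, hr, rfl⟩
    have e : V i * q * star (V j) * (V k * r * star (V l)) =
        V i * (q * (star (V j) * V k) * r) * star (V l) := by simp only [mul_assoc]
    rw [e]
    by_cases hjk : j = k
    · subst hjk
      exact Submodule.subset_span ⟨i, hi, l, hl, _, hmul _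
        (hmul _ hq _ (hQT (Or.inr (Or.inr ⟨j, hj, rfl⟩)))) _ hr, rfl⟩
    · rw [h.star_mul_eq_zero j k hjk]
      simp
  have hone : (1 : K →L[ℂ] K) ∈ Submodule.span ℂ (frameGenerators N V T) := by
    rw [← h.support_eq_one]
    refine sum_mem fun i hi => Submodule.subset_span ?_
    exact ⟨i, Finset.mem_range.1 hi, i, Finset.mem_range.1 hi, P,
      hQT (Or.inr (Or.inl rfl)), by rw [h.mul_p]⟩
  let L := Submodule.span ℂ (frameGenerators N V T)
  have hLfin : FiniteDimensional ℂ L :=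
    FiniteDimensional.span_of_finite ℂ (finite_frameGenerators hT)
  let D : StarSubalgebra ℂ (K →L[ℂ] K) :=
    { L with
      mul_mem' := fun {a b} ha hb => by
        have := Submodule.mul_mem_mul (M := L) (N := L) ha hb
        rw [Submodule.span_mul_span] at this
        refine Submodule.span_le.2 ?_ this
        rintro _ ⟨x, hx, y, hy, rfl⟩
        exact hgmul x hx y hy
      one_mem' := hone
      algebraMap_mem' := fun c => by
        rw [Algebra.algebraMap_eq_smul_one]
        exact L.smul_mem c hone
      star_mem' := fun {a} ha => by
        change a ∈ Submodule.span ℂ _ at ha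
        change star a ∈ Submodule.span ℂ _
        induction ha using Submodule.span_induction with
        | mem x hx =>
          obtain ⟨i, hi, j, hj, q, hq, rfl⟩ := hx
          refine Submodule.subset_span ⟨j, hj, i, hi, q, hq, ?_⟩
          simp [(hTP hq).1.isSelfAdjoint.star_eq, mul_assoc]
        | zero => simp
        | add x y _ _ hx hy => rw [star_add]; exact add_mem hx hy
        | smul c x _ hx => rw [star_smul]; exact Submodule.smul_mem _ _ hx }
  refine ⟨D, fun x hx => ?_, hLfin, fun x hx => ?_⟩
  · change x ∈ Submodule.span ℂ _ at hx
    refine (Submodule.span_le (p := Subalgebra.toSubmodule M.toSubalgebra)).2 ?_ hx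
    rintro _ ⟨i, -, j, -, q, hq, rfl⟩
    change V i * q * star (V j) ∈ M
    exact mul_mem (mul_mem (h.mem i) (hTP hq).2.1) (star_mem (h.mem j))
  · exact Submodule.span_mono (frameGenerators_mono (Set.subset_union_left.trans hQT)) hx

theorem isLFSet (hM : IsBicommutantClosed M) (h : IsAbelianFrame M N P V) :
    IsLFSet (M : Set (K →L[ℂ] K)) := by
  intro F hF ε hε
  have happ : ∀ b ∈ F, ∃ Q ⊆ cornerProjections M P, Q.Finite ∧
      ∃ d ∈ Submodule.span ℂ (frameGenerators N V Q), ‖b - d‖ < ε := by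
    intro b hb
    obtain ⟨d, hd, hbd⟩ := Metric.mem_closure_iff.1 (h.mem_closure_span hM (hF hb)) ε hε
    obtain ⟨Q, hQ, hQf, hdQ⟩ := exists_finite_mem_span_frameGenerators hd
    exact ⟨Q, hQ, hQf, d, hdQ, by rwa [← dist_eq_norm]⟩
  choose! Q hQ hQf d hd hbd using happ
  obtain ⟨D, hDM, hDf, hD⟩ := h.exists_starSubalgebra
    (F.finite_toSet.biUnion fun b hb => hQf b hb) (Set.iUnion₂_subset fun b hb => hQ b hb)
  refine ⟨D, hDM, hDf, fun b hb => ⟨d b, hD _ ?_, hbd b hb⟩⟩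
  exact Submodule.span_mono
    (frameGenerators_mono (Set.subset_biUnion_of_mem (u := Q) (Finset.mem_coe.2 hb))) (hd b hb)

end IsAbelianFrame

section Bidual

variable {S : StarSubalgebra ℂ (K →L[ℂ] K)}

theorem mem_bidualIn {y : K →L[ℂ] K} :
    y ∈ bidualIn S ↔ ∀ t : K →L[ℂ] K, (∀ a ∈ S, Commute t a) → Commute t y := by
  have key : ∀ t : K →L[ℂ] K, t ∈ StarSubalgebra.centralizer ℂ (S : Set (K →L[ℂ] K)) ↔
      ∀ a ∈ S, Commute t a := by
    intro t
    rw [StarSubalgebra.mem_centralizer_iff]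
    exact ⟨fun h a ha => (h a ha).1.symm,
      fun h a ha => ⟨(h a ha).eq.symm, (h _ (star_mem ha)).eq.symm⟩⟩
  rw [bidualIn, StarSubalgebra.mem_centralizer_iff]
  refine ⟨fun h t ht => (h t ((key t).2 ht)).1, fun h t ht => ⟨h t ((key t).1 ht), ?_⟩⟩
  exact h _ ((key _).1 (star_mem ht))

theorem le_bidualIn (S : StarSubalgebra ℂ (K →L[ℂ] K)) : S ≤ bidualIn S :=
  fun a ha => mem_bidualIn.2 fun _ ht => ht a ha

theorem bidualIn_mono {T : StarSubalgebra ℂ (K →L[ℂ] K)} (h : S ≤ T) :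
    bidualIn S ≤ bidualIn T :=
  fun _ hy => mem_bidualIn.2 fun t ht => mem_bidualIn.1 hy t fun a ha => ht a (h ha)

theorem isBicommutantClosed_bidualIn (S : StarSubalgebra ℂ (K →L[ℂ] K)) :
    IsBicommutantClosed (bidualIn S) :=
  fun _ hx => mem_bidualIn.2 fun t ht => hx t fun _ hm => mem_bidualIn.1 hm t ht

theorem isClosed_bidualIn (S : StarSubalgebra ℂ (K →L[ℂ] K)) :
    IsClosed (bidualIn S : Set (K →L[ℂ] K)) := by
  have : (bidualIn S : Set (K →L[ℂ] K)) =
      ⋂ (t : K →L[ℂ] K) (_ : ∀ a ∈ S, Commute t a), {y | t * y = y * t} := by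
    ext y
    simp only [Set.mem_iInter]
    exact mem_bidualIn
  rw [this]
  exact isClosed_iInter fun t => isClosed_iInter fun _ => isClosed_eq (by fun_prop) (by fun_prop)

/-- The diagonal operator on `ℓ²(ι, K)` with entries `t`. -/
def diagonalOperator (ι : Type*) [Fintype ι] (t : K →L[ℂ] K) :
    PiLp 2 (fun _ : ι => K) →L[ℂ] PiLp 2 (fun _ : ι => K) :=
  (PiLp.continuousLinearEquiv 2 ℂ fun _ : ι => K).symm.toContinuousLinearMap ∘L
    ContinuousLinearMap.piMap (fun _ => t) ∘L
      (PiLp.continuousLinearEquiv 2 ℂ fun _ : ι => K).toContinuousLinearMap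

variable {ι : Type*} [Fintype ι]

@[simp]
theorem diagonalOperator_apply {E : Type*} [NormedAddCommGroup E] [InnerProductSpace ℂ E]
    (t : E →L[ℂ] E) (x : PiLp 2 (fun _ : ι => E)) (i : ι) :
    diagonalOperator ι t x i = t (x i) := rfl

theorem star_diagonalOperator (t : K →L[ℂ] K) :
    star (diagonalOperator ι t) = diagonalOperator ι (star t) := by
  rw [ContinuousLinearMap.star_eq_adjoint, eq_comm, ContinuousLinearMap.eq_adjoint_iff]
  intro x y
  simp [PiLp.inner_apply, ContinuousLinearMap.star_eq_adjoint,
    ContinuousLinearMap.adjoint_inner_left]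

/-- An operator commuting with `S` on the diagonal commutes with the bicommutant of `S` on the
diagonal. -/
theorem commute_diagonalOperator_of_mem_bidualIn {y : K →L[ℂ] K} (hy : y ∈ bidualIn S)
    {E : PiLp 2 (fun _ : ι => K) →L[ℂ] PiLp 2 (fun _ : ι => K)}
    (hE : ∀ a ∈ S, Commute (diagonalOperator ι a) E) : Commute (diagonalOperator ι y) E := by
  classical
  let inj : ι → K →L[ℂ] PiLp 2 (fun _ : ι => K) := fun j =>
    (PiLp.continuousLinearEquiv 2 ℂ fun _ : ι => K).symm.toContinuousLinearMap ∘L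
      ContinuousLinearMap.single ℂ (fun _ : ι => K) j
  let entry : ι → ι → K →L[ℂ] K := fun i j => PiLp.proj 2 (fun _ : ι => K) i ∘L E ∘L inj j
  have hentry : ∀ i j ζ, entry i j ζ = E (inj j ζ) i := fun _ _ _ => rfl
  have hdiag : ∀ (t : K →L[ℂ] K) j ζ, diagonalOperator ι t (inj j ζ) = inj j (t ζ) := by
    intro t j ζ
    ext i
    change t (Pi.single (M := fun _ => K) j ζ i) = Pi.single (M := fun _ => K) j (t ζ) i
    rcases eq_or_ne i j with rfl | hij
    · simp
    · simp [hij]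
  have hsum : ∀ x : PiLp 2 (fun _ : ι => K), ∑ j, inj j (x j) = x := by
    intro x
    apply (WithLp.ofLp_injective 2)
    rw [WithLp.ofLp_sum]
    exact Finset.univ_sum_single x.ofLp
  have hy' : ∀ i j, Commute (entry i j) y := fun i j => mem_bidualIn.1 hy _ fun a ha => by
    ext ζ
    change entry i j (a ζ) = a (entry i j ζ)
    rw [hentry, hentry, ← hdiag]
    exact congrArg (fun u : PiLp 2 (fun _ : ι => K) => u i)
      (DFunLike.congr_fun (hE a ha).eq (inj j ζ)).symm
  ext x i
  change diagonalOperator ι y (E x) i = E (diagonalOperator ι y x) i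
  have hx : ∀ i, E x i = ∑ j, entry i j (x j) := by
    intro i
    conv_lhs => rw [← hsum x, map_sum]
    simp [hentry]
  have hyx : E (diagonalOperator ι y x) i = ∑ j, entry i j (y (x j)) := by
    conv_lhs => rw [← hsum x, map_sum, map_sum]
    simp [hentry, hdiag]
  rw [diagonalOperator_apply, hx, hyx, map_sum]
  exact Finset.sum_congr rfl fun j _ => (DFunLike.congr_fun (hy' i j).eq (x j)).symm

/-- The bicommutant is contained in the strong closure. -/
theorem exists_mem_approx_of_mem_bidualIn {y : K →L[ℂ] K} (hy : y ∈ bidualIn S) (ξ : ι → K)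
    {δ : ℝ} (hδ : 0 < δ) : ∃ a ∈ S, ∀ i, ‖a (ξ i) - y (ξ i)‖ < δ := by
  let x : PiLp 2 (fun _ : ι => K) := WithLp.toLp 2 ξ
  let W₀ : Submodule ℂ (PiLp 2 (fun _ : ι => K)) :=
    { carrier := {w | ∃ a ∈ S, w = diagonalOperator ι a x}
      add_mem' := by
        rintro _ _ ⟨a, ha, rfl⟩ ⟨b, hb, rfl⟩
        exact ⟨a + b, add_mem ha hb, by ext; simp⟩
      zero_mem' := ⟨0, zero_mem _, by ext; simp⟩
      smul_mem' := by
        rintro c _ ⟨a, ha, rfl⟩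
        exact ⟨c • a, SMulMemClass.smul_mem c ha, by ext; simp⟩ }
  have hinv₀ : ∀ a ∈ S, ∀ w ∈ W₀, diagonalOperator ι a w ∈ W₀ := by
    rintro a ha _ ⟨b, hb, rfl⟩
    exact ⟨a * b, mul_mem ha hb, rfl⟩
  let W := W₀.topologicalClosure
  have hWc : CompleteSpace W := W₀.isClosed_topologicalClosure.completeSpace_coe
  have hinv : ∀ a ∈ S, ∀ w ∈ W, diagonalOperator ι a w ∈ W := fun a ha w hw =>
    map_mem_closure (diagonalOperator ι a).continuous hw (hinv₀ a ha)
  have hxW : x ∈ W := W₀.le_topologicalClosure ⟨1, one_mem _, rfl⟩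
  have hcomm := commute_diagonalOperator_of_mem_bidualIn hy (E := W.starProjection) fun a ha =>
    commute_starProjection_of_invariant W _ (hinv a ha)
      (by rw [star_diagonalOperator]; exact hinv _ (star_mem ha))
  have hyx : diagonalOperator ι y x ∈ W := by
    rw [← Submodule.starProjection_eq_self_iff]
    have h1 := DFunLike.congr_fun hcomm.eq x
    change diagonalOperator ι y (W.starProjection x) =
      W.starProjection (diagonalOperator ι y x) at h1
    rw [← h1, Submodule.starProjection_eq_self_iff.2 hxW]
  obtain ⟨_, ⟨a, ha, rfl⟩, hd⟩ := Metric.mem_closure_iff.1 hyx δ hδ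
  refine ⟨a, ha, fun i => ?_⟩
  rw [dist_comm, dist_eq_norm] at hd
  exact (PiLp.norm_apply_le (diagonalOperator ι a x - diagonalOperator ι y x) i).trans_lt hd

theorem sum_inner_eq_zero_of_mem_bidualIn {ξ η : ι → K}
    (h : ∀ a ∈ S, ∑ i, inner ℂ (η i) (a (ξ i)) = 0) {y : K →L[ℂ] K} (hy : y ∈ bidualIn S) :
    ∑ i, inner ℂ (η i) (y (ξ i)) = 0 := by
  by_contra hne
  have hpos : 0 < ‖∑ i, inner ℂ (η i) (y (ξ i))‖ := norm_pos_iff.2 hne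
  set c := ‖∑ i, inner ℂ (η i) (y (ξ i))‖
  have hC : 0 ≤ ∑ i, ‖η i‖ := Finset.sum_nonneg fun i _ => norm_nonneg _
  obtain ⟨a, ha, hay⟩ := exists_mem_approx_of_mem_bidualIn hy ξ
    (δ := c / (∑ i, ‖η i‖ + 1)) (by positivity)
  have h1 : ∑ i, inner ℂ (η i) (y (ξ i)) = ∑ i, inner ℂ (η i) (y (ξ i) - a (ξ i)) := by
    simp only [inner_sub_right, Finset.sum_sub_distrib, h a ha, sub_zero]
  have h2 : c ≤ ∑ i, ‖η i‖ * (c / (∑ i, ‖η i‖ + 1)) := by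
    calc c = ‖∑ i, inner ℂ (η i) (y (ξ i) - a (ξ i))‖ := by rw [← h1]
      _ ≤ _ := norm_sum_le_of_le _ fun i _ => (norm_inner_le_norm _ _).trans
        (mul_le_mul_of_nonneg_left (by rw [norm_sub_rev]; exact (hay i).le) (norm_nonneg _))
  rw [← Finset.sum_mul, mul_div_assoc', le_div_iff₀ (by positivity)] at h2
  nlinarith

end Bidual

/-- The closure of a real subspace of a complex Hilbert space is determined by the real parts of
inner products. -/
theorem mem_closure_of_re_inner {H : Type*} [NormedAddCommGroup H] [InnerProductSpace ℂ H]
    [CompleteSpace H] {W : Set H} (h0 : (0 : H) ∈ W) (hadd : ∀ v ∈ W, ∀ w ∈ W, v + w ∈ W)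
    (hsmul : ∀ c : ℝ, ∀ w ∈ W, (c : ℂ) • w ∈ W) {x : H}
    (hx : ∀ η : H, (∀ w ∈ W, (inner ℂ η w).re = 0) → (inner ℂ η x).re = 0) : x ∈ closure W := by
  let _ : InnerProductSpace ℝ H := InnerProductSpace.rclikeToReal ℂ H
  let W' : Submodule ℝ H :=
    { carrier := W
      zero_mem' := h0
      add_mem' := fun ha hb => hadd _ ha _ hb
      smul_mem' := fun c w hw => hsmul c w hw }
  suffices hmem : x ∈ Submodule.orthogonal (𝕜 := ℝ) (Submodule.orthogonal (𝕜 := ℝ) W') by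
    rw [Submodule.orthogonal_orthogonal_eq_closure] at hmem
    exact hmem
  rw [Submodule.mem_orthogonal]
  intro η hη
  rw [real_inner_eq_re_inner ℂ]
  refine hx η fun w hw => ?_
  have := (Submodule.mem_orthogonal' _ _).1 hη w hw
  rwa [real_inner_eq_re_inner ℂ] at this

theorem exists_isSelfAdjoint_approx_of_mem_bidualIn {S : StarSubalgebra ℂ (K →L[ℂ] K)}
    {ι : Type*} [Fintype ι] {h : K →L[ℂ] K} (hh : h ∈ bidualIn S) (hsa : IsSelfAdjoint h)
    (ξ : ι → K) {δ : ℝ} (hδ : 0 < δ) :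
    ∃ a ∈ S, IsSelfAdjoint a ∧ ∀ i, ‖a (ξ i) - h (ξ i)‖ < δ := by
  let x : PiLp 2 (fun _ : ι => K) := WithLp.toLp 2 ξ
  have hmem : diagonalOperator ι h x ∈
      closure {w | ∃ a ∈ S, IsSelfAdjoint a ∧ w = diagonalOperator ι a x} := by
    refine mem_closure_of_re_inner
      (W := {w | ∃ a ∈ S, IsSelfAdjoint a ∧ w = diagonalOperator ι a x}) ⟨0, zero_mem _, .zero _, by ext; simp⟩ ?_ ?_ ?_
    · rintro _ ⟨a, ha, hsa, rfl⟩ _ ⟨b, hb, hsb, rfl⟩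
      exact ⟨a + b, add_mem ha hb, hsa.add hsb, by ext; simp⟩
    · rintro c _ ⟨a, ha, hsa, rfl⟩
      refine ⟨(c : ℂ) • a, SMulMemClass.smul_mem _ ha, IsSelfAdjoint.smul ?_ hsa, by ext; simp⟩
      exact Complex.conj_ofReal c
    · intro η hη
      have hswap : ∀ a : K →L[ℂ] K, IsSelfAdjoint a →
          ∑ i, inner ℂ (ξ i) (a (η i)) = (starRingEnd ℂ) (∑ i, inner ℂ (η i) (a (ξ i))) := by
        intro a ha
        rw [map_sum]
        refine Finset.sum_congr rfl fun i _ => ?_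
        rw [inner_conj_symm, ← ContinuousLinearMap.adjoint_inner_left,
          ← ContinuousLinearMap.star_eq_adjoint, ha.star_eq]
      have hre : ∀ a : K →L[ℂ] K, IsSelfAdjoint a →
          ∑ i, inner ℂ (η i) (a (ξ i)) + ∑ i, inner ℂ (ξ i) (a (η i)) =
            ((2 * (inner ℂ η (diagonalOperator ι a x)).re : ℝ) : ℂ) := by
        intro a ha
        rw [hswap a ha, Complex.add_conj, PiLp.inner_apply]
        rfl
      have hS : ∀ a ∈ S,
          ∑ i, inner ℂ (η i) (a (ξ i)) + ∑ i, inner ℂ (ξ i) (a (η i)) = 0 := by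
        intro a ha
        have sa : ∀ b ∈ S, IsSelfAdjoint b →
            ∑ i, inner ℂ (η i) (b (ξ i)) + ∑ i, inner ℂ (ξ i) (b (η i)) = 0 := by
          intro b hb hsb
          rw [hre b hsb, hη _ ⟨b, hb, hsb, rfl⟩]
          simp
        have hR : (realPart a : K →L[ℂ] K) ∈ S := by
          rw [realPart_apply_coe, ← Complex.coe_smul]
          exact SMulMemClass.smul_mem _ (add_mem ha (star_mem ha))
        have hI : (imaginaryPart a : K →L[ℂ] K) ∈ S := by
          rw [imaginaryPart_apply_coe, ← Complex.coe_smul]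
          exact SMulMemClass.smul_mem (-Complex.I) (SMulMemClass.smul_mem _
            (sub_mem ha (star_mem ha)))
        have h1 := sa _ hR (realPart a).2
        have h2 := sa _ hI (imaginaryPart a).2
        rw [← realPart_add_I_smul_imaginaryPart a]
        simp only [add_apply, smul_apply, inner_add_right,
          inner_smul_right, Finset.sum_add_distrib, ← Finset.mul_sum]
        linear_combination h1 + Complex.I * h2
      have hbi := sum_inner_eq_zero_of_mem_bidualIn (S := S) (ι := ι ⊕ ι)
        (ξ := Sum.elim ξ η) (η := Sum.elim η ξ)
        (fun a ha => by simpa using hS a ha) hh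
      simp only [Fintype.sum_sum_type, Sum.elim_inl, Sum.elim_inr] at hbi
      rw [hre h hsa] at hbi
      have := Complex.ofReal_eq_zero.1 hbi
      linarith
  obtain ⟨_, ⟨a, ha, hsaa, rfl⟩, hd⟩ := Metric.mem_closure_iff.1 hmem δ hδ
  refine ⟨a, ha, hsaa, fun i => ?_⟩
  rw [dist_comm, dist_eq_norm] at hd
  exact (PiLp.norm_apply_le (diagonalOperator ι a x - diagonalOperator ι h x) i).trans_lt hd

/-- A continuous tent function on `ℝ` supported on `[-1/2, 1/2]`, of the form `1 - u * g u` with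
`|g| ≤ 2`. -/
def tent (u : ℝ) : ℝ := 1 - u * (4 * u / max 1 (4 * u ^ 2))

theorem tent_eq_zero {u : ℝ} (hu : 1 ≤ 4 * u ^ 2) : tent u = 0 := by
  have : u ≠ 0 := by rintro rfl; norm_num at hu
  rw [tent, max_eq_right hu]
  field_simp
  ring

theorem abs_tent_le_one (u : ℝ) : |tent u| ≤ 1 := by
  rcases le_total 1 (4 * u ^ 2) with h | h
  · rw [tent_eq_zero h]; simp
  · rw [tent, max_eq_left h, abs_le]
    constructor <;> nlinarith [sq_nonneg u]

theorem abs_tentSlope_le_two (u : ℝ) : |4 * u / max 1 (4 * u ^ 2)| ≤ 2 := by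
  have h1 : (0 : ℝ) < max 1 (4 * u ^ 2) := lt_max_of_lt_left one_pos
  rw [abs_div, abs_of_pos h1, div_le_iff₀ h1, abs_le]
  constructor <;>
    nlinarith [le_max_left 1 (4 * u ^ 2), le_max_right 1 (4 * u ^ 2), sq_nonneg (2 * u - 1),
      sq_nonneg (2 * u + 1)]

theorem continuous_tentSlope : Continuous fun u : ℝ => 4 * u / max 1 (4 * u ^ 2) :=
  Continuous.div (by fun_prop) (by fun_prop) fun _ => (lt_max_of_lt_left one_pos).ne'

theorem continuous_tent : Continuous tent :=
  continuous_const.sub (continuous_id.mul continuous_tentSlope)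

theorem tent_mul_tent {i j : ℕ} (hij : i ≠ j) (x : ℝ) : tent (x - i) * tent (x - j) = 0 := by
  rcases le_or_gt 1 (4 * (x - i) ^ 2) with h | h
  · rw [tent_eq_zero h, zero_mul]
  · rw [tent_eq_zero (u := x - j), mul_zero]
    by_contra! h'
    have hsq : (1 : ℝ) ≤ ((i : ℝ) - j) ^ 2 := by
      have : (1 : ℤ) ≤ ((i : ℤ) - j) ^ 2 := by
        have : ((i : ℤ) - j) ≠ 0 := by omega
        have := sq_pos_of_ne_zero this
        omega
      exact_mod_cast this
    nlinarith [sq_nonneg ((x - i) + (x - j))]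

/-- Mutually orthogonal bumps in the functional calculus of a self-adjoint element, concentrated
near the integers. -/
theorem exists_orthogonal_bumps {S : StarSubalgebra ℂ (K →L[ℂ] K)}
    (hS : IsClosed (S : Set (K →L[ℂ] K))) {a : K →L[ℂ] K} (ha : a ∈ S) (hsa : IsSelfAdjoint a) :
    ∃ d : ℕ → K →L[ℂ] K, (∀ i, d i ∈ S) ∧ (∀ i j, i ≠ j → d i * d j = 0) ∧ (∀ i, ‖d i‖ ≤ 1) ∧
      ∀ (i : ℕ) (ξ : K), ‖d i ξ - ξ‖ ≤ 2 * ‖a ξ - (i : ℂ) • ξ‖ := by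
  have hct : ∀ i : ℕ, Continuous fun x : ℝ => tent (x - i) := fun i =>
    continuous_tent.comp (by fun_prop)
  have hcs : ∀ i : ℕ, Continuous fun x : ℝ => 4 * (x - i) / max 1 (4 * (x - i) ^ 2) := fun i =>
    continuous_tentSlope.comp (g := fun u : ℝ => 4 * u / max 1 (4 * u ^ 2)) (by fun_prop)
  have hprod : ∀ i : ℕ,
      Continuous fun x : ℝ => 4 * (x - i) / max 1 (4 * (x - i) ^ 2) * (x - i) := fun i =>
    (hcs i).mul (by fun_prop)
  refine ⟨fun i => cfc (fun x : ℝ => tent (x - i)) a, fun i => ?_, fun i j hij => ?_, fun i => ?_,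
    fun i ξ => ?_⟩
  · exact cfc_mem (𝕜' := ℂ) (hs := hS) _ ha
  · rw [← cfc_mul _ _ a (hct i).continuousOn (hct j).continuousOn]
    simp only [tent_mul_tent hij]
    exact cfc_const_zero ℝ a
  · exact norm_cfc_le zero_le_one fun x _ => abs_tent_le_one _
  · have hfac : cfc (fun x : ℝ => tent (x - i)) a = 1 -
        cfc (fun x : ℝ => 4 * (x - i) / max 1 (4 * (x - i) ^ 2)) a * (a - (i : ℂ) • 1) := by
      have h1 : cfc (fun x : ℝ => x - i) a = a - (i : ℂ) • (1 : K →L[ℂ] K) := by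
        rw [cfc_sub (fun x : ℝ => x) (fun _ => (i : ℝ)) a, cfc_id' ℝ a, cfc_const _ a]
        congr 1
      rw [← h1, ← cfc_mul _ _ a (hcs i).continuousOn (by fun_prop), ← cfc_const_one ℝ a,
        ← cfc_sub (fun _ => 1) _ a continuousOn_const
          (hprod i).continuousOn]
      refine cfc_congr fun x _ => ?_
      simp only [tent]
      ring
    simp only [hfac]
    have : (1 - cfc (fun x : ℝ => 4 * (x - i) / max 1 (4 * (x - i) ^ 2)) a *
        (a - (i : ℂ) • 1) : K →L[ℂ] K) ξ - ξ =
        -cfc (fun x : ℝ => 4 * (x - i) / max 1 (4 * (x - i) ^ 2)) a (a ξ - (i : ℂ) • ξ) := by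
      simp
    rw [this, norm_neg]
    exact ContinuousLinearMap.le_of_opNorm_le _
      (norm_cfc_le zero_le_two fun x _ => abs_tentSlope_le_two _) _

section Shift

variable {R : Type*} [Ring R] {N : ℕ} {d b : ℕ → R}

/-- A weighted shift along the orthogonal elements `d 0, …, d N` with weights `b i`. -/
def weightedShift (N : ℕ) (d b : ℕ → R) : R :=
  ∑ i ∈ Finset.range N, d (i + 1) * b i * d i

theorem mul_weightedShift_of_ne (hd : ∀ i j, i ≠ j → d i * d j = 0) {j : ℕ}
    (hj : ∀ i < N, j ≠ i + 1) : d j * weightedShift N d b = 0 := by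
  rw [weightedShift, Finset.mul_sum]
  refine Finset.sum_eq_zero fun i hi => ?_
  rw [← mul_assoc, ← mul_assoc, hd j (i + 1) (hj i (Finset.mem_range.1 hi)), zero_mul, zero_mul]

theorem mul_weightedShift_succ (hd : ∀ i j, i ≠ j → d i * d j = 0) {k : ℕ} (hk : k < N) :
    d (k + 1) * weightedShift N d b = d (k + 1) * (d (k + 1) * (b k * d k)) := by
  rw [weightedShift, Finset.mul_sum, Finset.sum_eq_single k]
  · rw [mul_assoc (d (k + 1)) (b k)]
  · intro i _ hik
    rw [← mul_assoc, ← mul_assoc, hd (k + 1) (i + 1) (by omega), zero_mul, zero_mul]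
  · exact fun h => absurd (Finset.mem_range.2 hk) h

theorem mul_weightedShift_pow_eq_zero (hd : ∀ i j, i ≠ j → d i * d j = 0) {j k : ℕ}
    (hjk : j < k) : d j * weightedShift N d b ^ k = 0 := by
  induction k generalizing j with
  | zero => omega
  | succ k ih =>
    rw [pow_succ', ← mul_assoc]
    by_cases hj : ∀ i < N, j ≠ i + 1
    · rw [mul_weightedShift_of_ne hd hj, zero_mul]
    · push Not at hj
      obtain ⟨i, hi, rfl⟩ := hj
      rw [mul_weightedShift_succ hd hi, mul_assoc, mul_assoc, mul_assoc, ih (by omega)]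
      simp

theorem weightedShift_pow_eq_zero (hd : ∀ i j, i ≠ j → d i * d j = 0) :
    weightedShift N d b ^ (N + 1) = 0 := by
  rw [pow_succ', weightedShift, Finset.sum_mul]
  refine Finset.sum_eq_zero fun i hi => ?_
  rw [mul_assoc]
  exact (congrArg _ (mul_weightedShift_pow_eq_zero hd (Finset.mem_range.1 hi))).trans
    (mul_zero _)

end Shift

/-- Matrix units in the bicommutant of a subhomogeneous algebra have bounded size. -/
theorem isColumnSystem_bidualIn_le {S : StarSubalgebra ℂ (K →L[ℂ] K)}
    (hS : IsClosed (S : Set (K →L[ℂ] K))) {N : ℕ}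
    (hN : ∀ x ∈ S, (∃ m : ℕ, 0 < m ∧ x ^ m = 0) → x ^ N = 0) {n : ℕ} {p : K →L[ℂ] K}
    {v : ℕ → K →L[ℂ] K} (h : IsColumnSystem (bidualIn S) n p v) : n ≤ N := by
  by_contra! hn
  obtain ⟨ξ, hξ, hξp⟩ : ∃ ξ : K, ‖ξ‖ = 1 ∧ p ξ = ξ := by
    obtain ⟨ζ, hζ⟩ : ∃ ζ, p ζ ≠ 0 := by
      by_contra! hp
      exact h.ne_zero (ContinuousLinearMap.ext hp)
    refine ⟨((‖p ζ‖⁻¹ : ℝ) : ℂ) • p ζ, ?_, ?_⟩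
    · rw [norm_smul, Complex.norm_real, norm_inv, norm_norm, inv_mul_cancel₀ (norm_ne_zero_iff.2 hζ)]
    · rw [map_smul, ← mul_apply_eq_comp, h.proj.isIdempotentElem.eq]
  let e : ℕ → K := fun i => v i ξ
  have hve : ∀ i j, i < n → j < n → star (v i) (e j) = if i = j then ξ else 0 := by
    intro i j hi hj
    change (star (v i) * v j) ξ = _
    rw [h.inner i j hi hj]
    split_ifs
    · exact hξp
    · rfl
  have hnorm : ∀ i < n, ‖e i‖ = 1 := by
    intro i hi
    have h1 : inner ℂ (e i) (e i) = (1 : ℂ) := by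
      change inner ℂ (v i ξ) (e i) = (1 : ℂ)
      rw [← ContinuousLinearMap.adjoint_inner_right, ← ContinuousLinearMap.star_eq_adjoint,
        hve i i hi hi, if_pos rfl, inner_self_eq_norm_sq_to_K, hξ]
      simp
    have h2 : ‖e i‖ ^ 2 = 1 := by
      rw [← inner_self_eq_norm_sq (𝕜 := ℂ), h1]
      simp
    nlinarith [norm_nonneg (e i)]
  let g : K →L[ℂ] K := ∑ i ∈ Finset.range n, (i : ℂ) • (v i * star (v i))
  have hg : g ∈ bidualIn S := sum_mem fun i _ =>
    SMulMemClass.smul_mem _ (mul_mem (h.mem i) (star_mem (h.mem i)))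
  have hgsa : IsSelfAdjoint g := by
    change star (∑ i ∈ Finset.range n, (i : ℂ) • (v i * star (v i))) = _
    rw [star_sum]
    refine Finset.sum_congr rfl fun i _ => ?_
    simp
  have hge : ∀ j < n, g (e j) = (j : ℂ) • e j := by
    intro j hj
    change (∑ i ∈ Finset.range n, (i : ℂ) • (v i * star (v i))) (e j) = _
    rw [sum_apply, Finset.sum_eq_single j]
    · change (j : ℂ) • v j (star (v j) (e j)) = _
      rw [hve j j hj hj, if_pos rfl]
    · intro i hi hij
      change (i : ℂ) • v i (star (v i) (e j)) = _
      rw [hve i j (Finset.mem_range.1 hi) hj, if_neg hij, map_zero, smul_zero]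
    · exact fun h => absurd (Finset.mem_range.2 hj) h
  obtain ⟨δ, hδ, hδN⟩ : ∃ δ : ℝ, 0 < δ ∧ (5 * N + 2) * δ < 1 := by
    refine ⟨(5 * N + 3 : ℝ)⁻¹, by positivity, ?_⟩
    rw [← div_eq_mul_inv, div_lt_one (by positivity)]
    linarith
  obtain ⟨a, haS, hasa, ha⟩ := exists_isSelfAdjoint_approx_of_mem_bidualIn hg hgsa
    (fun i : Fin n => e i) hδ
  obtain ⟨d, hdS, hdd, hd1, hdξ⟩ := exists_orthogonal_bumps hS haS hasa
  have hde : ∀ i < n, ‖d i (e i) - e i‖ ≤ 2 * δ := fun i hi =>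
    (hdξ i (e i)).trans <| by
      have := ha ⟨i, hi⟩
      simp only [hge i hi] at this
      linarith
  have happ : ∀ (k : ℕ) (ζ : K), ∃ b ∈ S, ‖b ζ - v (k + 1) (star (v k) ζ)‖ < δ := by
    intro k ζ
    obtain ⟨b, hb, hbζ⟩ := exists_mem_approx_of_mem_bidualIn
      (mul_mem (h.mem (k + 1)) (star_mem (h.mem k))) (fun _ : Unit => ζ) hδ
    exact ⟨b, hb, hbζ ()⟩
  choose β hβS hβ using happ
  let η : ℕ → K := fun k => Nat.rec (d 0 (e 0)) (fun k ζ => d (k + 1) (d (k + 1) (β k ζ ζ))) k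
  let b : ℕ → K →L[ℂ] K := fun k => β k (η k)
  have hη : ∀ k, η (k + 1) = d (k + 1) (d (k + 1) (b k (η k))) := fun _ => rfl
  have dle : ∀ i ζ, ‖d i ζ‖ ≤ ‖ζ‖ := fun i ζ => by
    simpa using (d i).le_of_opNorm_le (hd1 i) ζ
  have hηe : ∀ k < n, ‖η k - e k‖ ≤ (5 * k + 2) * δ := by
    intro k
    induction k with
    | zero =>
      intro hk
      simpa [η] using hde 0 hk
    | succ k ih =>
      intro hk
      have ih := ih (by omega)
      have h1 := hβ k (η k)
      have h2 : ‖v (k + 1) (star (v k) (η k)) - e (k + 1)‖ ≤ ‖η k - e k‖ := by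
        have : v (k + 1) (star (v k) (η k)) - e (k + 1) =
            v (k + 1) (star (v k) (η k - e k)) := by
          rw [map_sub, map_sub, hve k k (by omega) (by omega), if_pos rfl]
        rw [this]
        have n1 := (v (k + 1)).le_of_opNorm_le (h.norm_le_one (k + 1)) (star (v k) (η k - e k))
        have n2 := (star (v k)).le_of_opNorm_le ((norm_star _).trans_le (h.norm_le_one k))
          (η k - e k)
        linarith
      have h3 : ‖b k (η k) - e (k + 1)‖ ≤ δ + (5 * k + 2) * δ := by
        have := norm_add_le (b k (η k) - v (k + 1) (star (v k) (η k)))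
          (v (k + 1) (star (v k) (η k)) - e (k + 1))
        rw [sub_add_sub_cancel] at this
        linarith
      have step : ∀ ζ, ‖d (k + 1) ζ - e (k + 1)‖ ≤ ‖ζ - e (k + 1)‖ + 2 * δ := by
        intro ζ
        have := norm_add_le (d (k + 1) ζ - d (k + 1) (e (k + 1)))
          (d (k + 1) (e (k + 1)) - e (k + 1))
        rw [sub_add_sub_cancel, ← map_sub] at this
        linarith [dle (k + 1) (ζ - e (k + 1)), hde (k + 1) hk]
      rw [hη]
      have h4 := step (b k (η k))
      have h5 := step (d (k + 1) (b k (η k)))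
      push_cast
      linarith
  let x := weightedShift N d b
  have hxS : x ∈ S := sum_mem fun i _ => mul_mem (mul_mem (hdS _) (hβS _ _)) (hdS _)
  have hdx : ∀ k ≤ N, (d k * x ^ k) (e 0) = η k := by
    intro k
    induction k with
    | zero =>
      intro _
      simp [η]
    | succ k ih =>
      intro hk
      rw [hη, ← ih (by omega), pow_succ', ← mul_assoc, mul_weightedShift_succ hdd (by omega)]
      rfl
  have h0 : x ^ N = 0 := hN x hxS ⟨N + 1, N.succ_pos, weightedShift_pow_eq_zero hdd⟩
  have h1 := hdx N le_rfl
  rw [h0, mul_zero] at h1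
  have h2 := hηe N hn
  rw [← h1, zero_apply, zero_sub, norm_neg, hnorm N hn] at h2
  linarith

/-- The bicommutant of a subhomogeneous C*-algebra is an LF C*-algebra. -/
theorem IsSubhomogeneous.isLFSet_bidualIn {S : StarSubalgebra ℂ (K →L[ℂ] K)}
    (hS : IsClosed (S : Set (K →L[ℂ] K))) (h : IsSubhomogeneous S) :
    IsLFSet (bidualIn S : Set (K →L[ℂ] K)) := by
  obtain ⟨N, -, hN⟩ := h
  obtain ⟨P, V, hPV⟩ := exists_isAbelianFrame (isBicommutantClosed_bidualIn S)
    fun n p v hv => isColumnSystem_bidualIn_le hS hN hv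
  exact hPV.isLFSet (isBicommutantClosed_bidualIn S)

/-- The closure of a directed union of LF C*-algebras is an LF C*-algebra. -/
theorem isLFSet_closure_iUnion {I : Type*} [Nonempty I]
    {B : I → StarSubalgebra ℂ (K →L[ℂ] K)} (hdir : Directed (· ≤ ·) B)
    (hB : ∀ i, IsLFSet (B i : Set (K →L[ℂ] K))) :
    IsLFSet (closure (⋃ i, (B i : Set (K →L[ℂ] K)))) := by
  classical
  intro F hF ε hε
  have happ : ∀ b ∈ F, ∃ c i, c ∈ B i ∧ ‖b - c‖ < ε / 2 := by
    intro b hb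
    obtain ⟨c, hc, hbc⟩ := Metric.mem_closure_iff.1 (hF hb) (ε / 2) (by positivity)
    obtain ⟨i, hi⟩ := Set.mem_iUnion.1 hc
    exact ⟨c, i, hi, by rwa [← dist_eq_norm]⟩
  choose! c i hc hbc using happ
  obtain ⟨k, hk⟩ := hdir.finset_le (F.image i)
  obtain ⟨D, hDB, hDf, hD⟩ := hB k (F.image c) (by
    intro y hy
    obtain ⟨b, hb, rfl⟩ := Finset.mem_image.1 (Finset.mem_coe.1 hy)
    exact hk _ (Finset.mem_image_of_mem i hb) (hc b hb)) (ε / 2) (by positivity)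
  refine ⟨D, fun y hy => subset_closure (Set.mem_iUnion.2 ⟨k, hDB hy⟩), hDf, fun b hb => ?_⟩
  obtain ⟨y, hy, hcy⟩ := hD (c b) (Finset.mem_image_of_mem c hb)
  refine ⟨y, hy, ?_⟩
  have := norm_add_le (b - c b) (c b - y)
  rw [sub_add_sub_cancel] at this
  linarith [hbc b hb]

theorem stmt17 {I : Type*} [Nonempty I]
    (𝒜fam : I → StarSubalgebra ℂ (K →L[ℂ] K))
    (hdir : Directed (· ≤ ·) 𝒜fam)
    (hclosed : ∀ i, IsClosed ((𝒜fam i : Set (K →L[ℂ] K))))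
    (hsubhom : ∀ i, IsSubhomogeneous (𝒜fam i))
    (𝒜 : StarSubalgebra ℂ (K →L[ℂ] K))
    (h𝒜 : (𝒜 : Set (K →L[ℂ] K)) = closure (⋃ i, (𝒜fam i : Set (K →L[ℂ] K)))) :
    (𝒜 : Set (K →L[ℂ] K)) ⊆ closure (⋃ i, (bidualIn (𝒜fam i) : Set (K →L[ℂ] K))) ∧
    closure (⋃ i, (bidualIn (𝒜fam i) : Set (K →L[ℂ] K))) ⊆
      (bidualIn 𝒜 : Set (K →L[ℂ] K)) ∧
    IsLFSet (closure (⋃ i, (bidualIn (𝒜fam i) : Set (K →L[ℂ] K)))) ∧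
    ∃ B : Set (K →L[ℂ] K), IsLFSet B ∧ (𝒜 : Set (K →L[ℂ] K)) ⊆ B ∧
      B ⊆ (bidualIn 𝒜 : Set (K →L[ℂ] K)) := by
  have hle : (𝒜 : Set (K →L[ℂ] K)) ⊆ closure (⋃ i, (bidualIn (𝒜fam i) : Set (K →L[ℂ] K))) := by
    rw [h𝒜]
    exact closure_mono (Set.iUnion_mono fun i => le_bidualIn (𝒜fam i))
  have hfam : ∀ i, 𝒜fam i ≤ 𝒜 := fun i x hx => by
    rw [← SetLike.mem_coe, h𝒜]
    exact subset_closure (Set.mem_iUnion.2 ⟨i, hx⟩)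
  have hsub : closure (⋃ i, (bidualIn (𝒜fam i) : Set (K →L[ℂ] K))) ⊆
      (bidualIn 𝒜 : Set (K →L[ℂ] K)) :=
    closure_minimal (Set.iUnion_subset fun i => bidualIn_mono (hfam i)) (isClosed_bidualIn 𝒜)
  have hLF := isLFSet_closure_iUnion (B := fun i => bidualIn (𝒜fam i))
    (fun i j => (hdir i j).imp fun _ h => ⟨bidualIn_mono h.1, bidualIn_mono h.2⟩)
    fun i => (hsubhom i).isLFSet_bidualIn (hclosed i)
  exact ⟨hle, hsub, hLF, _, hLF, hle, hsub⟩

end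
end
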